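/- (Representation of harmonic fields vanishing at infinity, vector case) If ū is a C¹ vector field on ℝ³ ∖ K (K compact) with curl ū = 0, div ū = 0, and ū(x) → 0 as ‖x‖ → ∞, then assuming the duality theorem for p̄(K), there exist a scalar function f and a vector field v̄ on ℝ³ ∖ K, both vanishing at infinity, with Δf = 0, Δv̄ = 0, div v̄ = 0, and ū = grad f + curl v̄ on ℝ³ ∖ K. -/

import Mathlib

open MeasureTheory
open scoped BigOperators

noncomputable section

abbrev Euc (n : ℕ) := EuclideanSpace ℝ (Fin n)

abbrev Cov (n : ℕ) := Finset (Fin n) → ℝ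

/-- Sign of the shuffle merging `t` and `u`. -/
def eps {n : ℕ} (t u : Finset (Fin n)) : ℝ :=
  (-1 : ℝ) ^ (((t ×ˢ u).filter fun p => p.2 < p.1).card)

/-- Exterior (wedge) product of covectors in coordinates. -/
def wedge {n : ℕ} (ξ η : Cov n) : Cov n :=
  fun s => ∑ t ∈ s.powerset, eps t (s \ t) * ξ t * η (s \ t)

/-- Hodge star in coordinates. -/
def hodge {n : ℕ} (ξ : Cov n) : Cov n := fun s => eps sᶜ s * ξ sᶜ

/-- Inner product of covectors, making the basic covectors orthonormal. -/
def covInner {n : ℕ} (ξ η : Cov n) : ℝ := ∑ s : Finset (Fin n), ξ s * η s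

def covNorm {n : ℕ} (ξ : Cov n) : ℝ := Real.sqrt (covInner ξ ξ)

/-- `ξ` is a covector of pure degree `r`. -/
def IsDeg {n : ℕ} (r : ℕ) (ξ : Cov n) : Prop := ∀ s, ξ s ≠ 0 → s.card = r

abbrev Form (n : ℕ) := Euc n → Cov n

/-- Exterior derivative in coordinates. -/
def extD {n : ℕ} (u : Form n) : Form n :=
  fun x s => ∑ i ∈ s, eps {i} (s.erase i) *
    fderiv ℝ (fun y => u y (s.erase i)) x (EuclideanSpace.single i (1 : ℝ))

def hodgeF {n : ℕ} (u : Form n) : Form n := fun x => hodge (u x)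

/-- Codifferential `δu = (-1)^{nr+r+1} ∗d∗u` of an `r`-form. -/
def codiff {n : ℕ} (r : ℕ) (u : Form n) : Form n :=
  fun x => ((-1 : ℝ) ^ (n * r + r + 1)) • hodge (extD (hodgeF u) x)

/-- All coefficients of `u` are of class `C^k` on `O`. -/
def FormClass {n : ℕ} (k : ℕ∞) (O : Set (Euc n)) (u : Form n) : Prop :=
  ∀ s, ContDiffOn ℝ k (fun x => u x s) O

/-- Partial derivative in the `i`-th coordinate direction. -/
def pderiv {n : ℕ} (i : Fin n) (f : Euc n → ℝ) : Euc n → ℝ :=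
  fun x => fderiv ℝ f x (EuclideanSpace.single i (1 : ℝ))

/-- The `1`-form corresponding to a vector field on `ℝ³`. -/
def oneFormOf (u : Euc 3 → Fin 3 → ℝ) : Form 3 :=
  fun x s => ∑ i, if s = {i} then u x i else 0

/-- The curl of a vector field on `ℝ³`. -/
def curl (u : Euc 3 → Fin 3 → ℝ) : Euc 3 → Fin 3 → ℝ := fun x =>
  ![pderiv 1 (fun y => u y 2) x - pderiv 2 (fun y => u y 1) x,
    pderiv 2 (fun y => u y 0) x - pderiv 0 (fun y => u y 2) x,
    pderiv 0 (fun y => u y 1) x - pderiv 1 (fun y => u y 0) x]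

/-- The divergence of a vector field on `ℝ³`. -/
def divg (u : Euc 3 → Fin 3 → ℝ) : Euc 3 → ℝ :=
  fun x => ∑ i, pderiv i (fun y => u y i) x


/-- The Laplacian of a scalar function. -/
def lap {n : ℕ} (f : Euc n → ℝ) : Euc n → ℝ := fun x => ∑ i, pderiv i (pderiv i f) x

open Filter Topology Set
open scoped ContDiff

theorem Filter.EventuallyEq.pderiv {n : ℕ} {f g : Euc n → ℝ} {x : Euc n} (h : f =ᶠ[𝓝 x] g)
    (i : Fin n) : pderiv i f =ᶠ[𝓝 x] pderiv i g :=
  (h.fderiv (𝕜 := ℝ)).mono fun y hy => by simp only [_root_.pderiv, hy]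

theorem Filter.EventuallyEq.lap_eq {n : ℕ} {f g : Euc n → ℝ} {x : Euc n} (h : f =ᶠ[𝓝 x] g) :
    lap f x = lap g x :=
  Finset.sum_congr rfl fun i _ => ((h.pderiv i).pderiv i).eq_of_nhds

theorem ContDiffAt.pderiv {n : ℕ} {f : Euc n → ℝ} {x : Euc n} {k m : ℕ∞ω}
    (hf : ContDiffAt ℝ k f x) (i : Fin n) (hmk : m + 1 ≤ k) : ContDiffAt ℝ m (pderiv i f) x :=
  (hf.fderiv_right hmk).clm_apply contDiffAt_const

theorem ContDiff.pderiv {n : ℕ} {f : Euc n → ℝ} {k m : ℕ∞ω}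
    (hf : ContDiff ℝ k f) (i : Fin n) (hmk : m + 1 ≤ k) : ContDiff ℝ m (pderiv i f) :=
  contDiff_iff_contDiffAt.2 fun _ => hf.contDiffAt.pderiv i hmk

theorem ContDiffAt.lap {n : ℕ} {f : Euc n → ℝ} {x : Euc n}
    (hf : ContDiffAt ℝ ∞ f x) : ContDiffAt ℝ ∞ (lap f) x :=
  ContDiffAt.sum fun i _ => (hf.pderiv i (m := ∞) (by simp)).pderiv i (by simp)

theorem pderiv_eq_zero_of_eventuallyEq_zero {n : ℕ} {f : Euc n → ℝ} {x : Euc n}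
    (h : f =ᶠ[𝓝 x] fun _ => 0) (i : Fin n) : pderiv i f x = 0 := by
  rw [(h.pderiv i).eq_of_nhds]; simp [pderiv]

theorem lap_zero {n : ℕ} (x : Euc n) : lap (fun _ => 0) x = 0 :=
  Finset.sum_eq_zero fun i _ => pderiv_eq_zero_of_eventuallyEq_zero
    (Eventually.of_forall fun _ => by simp [pderiv]) i

theorem pderiv_add {n : ℕ} {f g : Euc n → ℝ} {x : Euc n} (hf : DifferentiableAt ℝ f x)
    (hg : DifferentiableAt ℝ g x) (i : Fin n) :
    pderiv i (fun y => f y + g y) x = pderiv i f x + pderiv i g x := by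
  simp only [pderiv]; rw [fderiv_fun_add hf hg]; rfl

theorem pderiv_sub {n : ℕ} {f g : Euc n → ℝ} {x : Euc n} (hf : DifferentiableAt ℝ f x)
    (hg : DifferentiableAt ℝ g x) (i : Fin n) :
    pderiv i (fun y => f y - g y) x = pderiv i f x - pderiv i g x := by
  simp only [pderiv]; rw [fderiv_fun_sub hf hg]; rfl

theorem pderiv_neg {n : ℕ} {f : Euc n → ℝ} {x : Euc n} (i : Fin n) :
    pderiv i (fun y => - f y) x = - pderiv i f x := by
  simp only [pderiv]; rw [fderiv_fun_neg]; rfl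

theorem pderiv_const_mul {n : ℕ} {f : Euc n → ℝ} {x : Euc n} (c : ℝ)
    (hf : DifferentiableAt ℝ f x) (i : Fin n) :
    pderiv i (fun y => c * f y) x = c * pderiv i f x := by
  simp only [pderiv]; rw [fderiv_const_mul hf]; rfl

theorem pderiv_mul {n : ℕ} {f g : Euc n → ℝ} {x : Euc n} (hf : DifferentiableAt ℝ f x)
    (hg : DifferentiableAt ℝ g x) (i : Fin n) :
    pderiv i (fun y => f y * g y) x = f x * pderiv i g x + g x * pderiv i f x := by
  simp only [pderiv]; rw [fderiv_fun_mul hf hg]; simp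

theorem pderiv_sum {n : ℕ} {ι : Type*} {s : Finset ι} {f : ι → Euc n → ℝ} {x : Euc n}
    (hf : ∀ j ∈ s, DifferentiableAt ℝ (f j) x) (i : Fin n) :
    pderiv i (fun y => ∑ j ∈ s, f j y) x = ∑ j ∈ s, pderiv i (f j) x := by
  simp only [pderiv]; rw [fderiv_fun_sum hf]; simp

theorem pderiv_comp_sub {n : ℕ} (f : Euc n → ℝ) (p x : Euc n) (i : Fin n) :
    pderiv i (fun y => f (y - p)) x = pderiv i f (x - p) := by
  simp only [pderiv]; rw [fderiv_comp_sub]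

theorem lap_comp_sub {n : ℕ} (f : Euc n → ℝ) (p x : Euc n) :
    lap (fun y => f (y - p)) x = lap f (x - p) := by
  simp only [lap]
  refine Finset.sum_congr rfl fun i _ => ?_
  rw [show pderiv i (fun y => f (y - p)) = fun y => pderiv i f (y - p) from
    funext fun y => pderiv_comp_sub f p y i, pderiv_comp_sub]

theorem ContDiffAt.eventually_differentiableAt {n : ℕ} {f : Euc n → ℝ} {x : Euc n}
    (hf : ContDiffAt ℝ 2 f x) : ∀ᶠ y in 𝓝 x, DifferentiableAt ℝ f y :=
  (hf.eventually (by simp)).mono fun _ hy => hy.differentiableAt (by simp)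

theorem ContDiffAt.differentiableAt_pderiv {n : ℕ} {f : Euc n → ℝ} {x : Euc n}
    (hf : ContDiffAt ℝ 2 f x) (i : Fin n) : DifferentiableAt ℝ (_root_.pderiv i f) x :=
  (hf.pderiv i (m := 1) (by norm_num)).differentiableAt (by simp)

theorem lap_add {n : ℕ} {f g : Euc n → ℝ} {x : Euc n} (hf : ContDiffAt ℝ 2 f x)
    (hg : ContDiffAt ℝ 2 g x) : lap (fun y => f y + g y) x = lap f x + lap g x := by
  simp only [lap, ← Finset.sum_add_distrib]
  refine Finset.sum_congr rfl fun i _ => ?_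
  rw [← pderiv_add (hf.differentiableAt_pderiv i) (hg.differentiableAt_pderiv i)]
  refine (EventuallyEq.pderiv ?_ i).eq_of_nhds
  filter_upwards [hf.eventually_differentiableAt, hg.eventually_differentiableAt] with y h1 h2
  exact pderiv_add h1 h2 i

theorem lap_const_mul {n : ℕ} {f : Euc n → ℝ} {x : Euc n} (c : ℝ) (hf : ContDiffAt ℝ 2 f x) :
    lap (fun y => c * f y) x = c * lap f x := by
  simp only [lap, Finset.mul_sum]
  refine Finset.sum_congr rfl fun i _ => ?_
  rw [← pderiv_const_mul c (hf.differentiableAt_pderiv i)]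
  refine (EventuallyEq.pderiv ?_ i).eq_of_nhds
  filter_upwards [hf.eventually_differentiableAt] with y h1
  exact pderiv_const_mul c h1 i

theorem lap_sum {n : ℕ} {ι : Type*} {s : Finset ι} {f : ι → Euc n → ℝ} {x : Euc n}
    (hf : ∀ j ∈ s, ContDiffAt ℝ 2 (f j) x) :
    lap (fun y => ∑ j ∈ s, f j y) x = ∑ j ∈ s, lap (f j) x := by
  classical
  induction s using Finset.induction_on with
  | empty => simpa using lap_zero x
  | insert a s ha ih =>
    simp only [Finset.sum_insert ha]
    rw [lap_add (hf a (by simp)) (ContDiffAt.sum fun j hj => hf j (by simp [hj])),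
      ih fun j hj => hf j (by simp [hj])]

theorem pderiv_comm {n : ℕ} {f : Euc n → ℝ} {x : Euc n} (hf : ContDiffAt ℝ 2 f x)
    (i j : Fin n) : pderiv i (pderiv j f) x = pderiv j (pderiv i f) x := by
  have hd : DifferentiableAt ℝ (fderiv ℝ f) x :=
    (hf.fderiv_right (m := 1) (by norm_num)).differentiableAt (by simp)
  have key : ∀ a b : Fin n, pderiv a (pderiv b f) x
      = fderiv ℝ (fderiv ℝ f) x (EuclideanSpace.single a 1) (EuclideanSpace.single b 1) := by
    intro a b
    have := fderiv_clm_apply hd (differentiableAt_const (EuclideanSpace.single b (1 : ℝ)))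
    change fderiv ℝ (fun y => fderiv ℝ f y (EuclideanSpace.single b 1)) x _ = _
    rw [this]
    simp
  rw [key, key]
  exact (hf.isSymmSndFDerivAt (by simp)) _ _

theorem lap_pderiv {n : ℕ} {f : Euc n → ℝ} {x : Euc n} (hf : ContDiffAt ℝ 3 f x)
    (i : Fin n) : lap (pderiv i f) x = pderiv i (lap f) x := by
  have h2 : ContDiffAt ℝ 2 f x := hf.of_le (by norm_num)
  rw [show lap f = fun y => ∑ j, pderiv j (pderiv j f) y from rfl,
    pderiv_sum fun j _ => ((hf.pderiv j (m := 2) (by norm_num)).differentiableAt_pderiv j)]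
  refine Finset.sum_congr rfl fun j _ => ?_
  have : pderiv j (pderiv i f) =ᶠ[𝓝 x] pderiv i (pderiv j f) :=
    (h2.eventually (by simp)).mono fun y hy => pderiv_comm hy j i
  rw [(this.pderiv j).eq_of_nhds]
  exact pderiv_comm (hf.pderiv j (by norm_num)) j i

theorem fderiv_eq_sum_pderiv {n : ℕ} (f : Euc n → ℝ) (x b : Euc n) :
    fderiv ℝ f x b = ∑ i, b i * pderiv i f x := by
  conv_lhs => rw [← (EuclideanSpace.basisFun (Fin n) ℝ).sum_repr b]
  simp [pderiv]

theorem HasCompactSupport.pderiv {n : ℕ} {f : Euc n → ℝ} (hf : HasCompactSupport f)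
    (i : Fin n) : HasCompactSupport (_root_.pderiv i f) :=
  hf.fderiv_apply (𝕜 := ℝ) _

theorem HasCompactSupport.lap {n : ℕ} {f : Euc n → ℝ} (hf : HasCompactSupport f) :
    HasCompactSupport (_root_.lap f) := by
  refine hf.mono' fun x hx => ?_
  by_contra hx'
  refine hx ?_
  have h0 : f =ᶠ[𝓝 x] fun _ => 0 := notMem_tsupport_iff_eventuallyEq.1 hx'
  rw [h0.lap_eq, lap_zero]

theorem integral_mul_pderiv_eq_neg {n : ℕ} {f g : Euc n → ℝ} (hf : ContDiff ℝ 1 f)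
    (hg : ContDiff ℝ 1 g) (hc : HasCompactSupport f) (i : Fin n) :
    ∫ x, f x * pderiv i g x = - ∫ x, pderiv i f x * g x := by
  have hf' : Continuous (pderiv i f) := (hf.pderiv i (m := 0) (by simp)).continuous
  have hg' : Continuous (pderiv i g) := (hg.pderiv i (m := 0) (by simp)).continuous
  refine integral_mul_fderiv_eq_neg_fderiv_mul_of_integrable ?_ ?_ ?_
    (fun x _ => hf.differentiable (by simp) x) (fun x _ => hg.differentiable (by simp) x)
  · exact (hf'.mul hg.continuous).integrable_of_hasCompactSupport (hc.pderiv i).mul_right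
  · exact (hf.continuous.mul hg').integrable_of_hasCompactSupport hc.mul_right
  · exact (hf.continuous.mul hg.continuous).integrable_of_hasCompactSupport hc.mul_right

theorem integral_mul_lap_eq {n : ℕ} {f g : Euc n → ℝ} (hf : ContDiff ℝ 2 f)
    (hg : ContDiff ℝ 2 g) (hc : HasCompactSupport f) :
    ∫ x, f x * lap g x = - ∫ x, ∑ i, pderiv i f x * pderiv i g x := by
  have hf' : ∀ i, ContDiff ℝ 1 (pderiv i f) := fun i => hf.pderiv i (by norm_num)
  have hg' : ∀ i, ContDiff ℝ 1 (pderiv i g) := fun i => hg.pderiv i (by norm_num)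
  have hg'' : ∀ i, ContDiff ℝ 0 (pderiv i (pderiv i g)) := fun i => (hg' i).pderiv i (by simp)
  simp only [lap, Finset.mul_sum]
  rw [integral_finsetSum, integral_finsetSum, ← Finset.sum_neg_distrib]
  · exact Finset.sum_congr rfl fun i _ =>
      integral_mul_pderiv_eq_neg (hf.of_le (by norm_num)) (hg' i) hc i
  · exact fun i _ => ((hf' i).continuous.mul (hg' i).continuous).integrable_of_hasCompactSupport
      (hc.pderiv i).mul_right
  · exact fun i _ => (hf.continuous.mul (hg'' i).continuous).integrable_of_hasCompactSupport
      hc.mul_right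

theorem exists_contDiff_eq_zero_eq_one_near {n : ℕ} {A B : Set (Euc n)} (hA : IsClosed A)
    (hB : IsClosed B) (hAB : Disjoint A B) :
    ∃ θ : Euc n → ℝ, ContDiff ℝ ∞ θ ∧ (∀ x ∈ A, θ =ᶠ[𝓝 x] fun _ => 0) ∧
      (∀ x ∈ B, θ =ᶠ[𝓝 x] fun _ => 1) := by
  obtain ⟨U, hU, hAU, hUB⟩ := normal_exists_closure_subset hA hB.isOpen_compl
    hAB.subset_compl_right
  obtain ⟨V, hV, hBV, hVU⟩ := normal_exists_closure_subset hB isClosed_closure.isOpen_compl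
    (subset_compl_comm.1 hUB)
  obtain ⟨f, hf, hfc, hf0⟩ := (isClosed_closure (s := U)).isOpen_compl.exists_contDiff_support_eq
    (n := ⊤)
  obtain ⟨g, hg, hgc, hg0⟩ := (isClosed_closure (s := V)).isOpen_compl.exists_contDiff_support_eq
    (n := ⊤)
  have hfn : ∀ x, 0 ≤ f x := fun x => (hf0 (mem_range_self x)).1
  have hgn : ∀ x, 0 ≤ g x := fun x => (hg0 (mem_range_self x)).1
  have hfz : ∀ x, f x = 0 ↔ x ∈ closure U := fun x => by
    rw [← Function.notMem_support, hf, notMem_compl_iff]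
  have hgz : ∀ x, g x = 0 ↔ x ∈ closure V := fun x => by
    rw [← Function.notMem_support, hg, notMem_compl_iff]
  have hne : ∀ x, f x + g x ≠ 0 := fun x hx => by
    have h1 : f x = 0 := by linarith [hfn x, hgn x]
    have h2 : g x = 0 := by linarith [hfn x, hgn x]
    exact hVU ((hgz x).1 h2) ((hfz x).1 h1)
  refine ⟨fun x => f x / (f x + g x), hfc.div (hfc.add hgc) hne, fun x hx => ?_, fun x hx => ?_⟩
  · filter_upwards [hU.mem_nhds (hAU hx)] with y hy
    simp [(hfz y).2 (subset_closure hy)]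
  · filter_upwards [hV.mem_nhds (hBV hx)] with y hy
    have h0 := (hgz y).2 (subset_closure hy)
    have h1 := hne y
    simp only [h0, add_zero] at h1 ⊢
    exact div_self h1

theorem ContDiffOn.contDiff_mul_of_eq_zero_near {n : ℕ} {k : ℕ∞} {U : Set (Euc n)}
    {u θ : Euc n → ℝ} (hU : IsOpen U) (hu : ContDiffOn ℝ k u U) (hθ : ContDiff ℝ ∞ θ)
    (h0 : ∀ x ∈ Uᶜ, θ =ᶠ[𝓝 x] fun _ => 0) : ContDiff ℝ k (fun x => θ x * u x) := by
  refine contDiff_iff_contDiffAt.2 fun x => ?_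
  by_cases hx : x ∈ U
  · exact (hθ.contDiffAt.of_le (by exact_mod_cast le_top)).mul (hu.contDiffAt (hU.mem_nhds hx))
  · refine (contDiffAt_const (c := (0 : ℝ))).congr_of_eventuallyEq ?_
    filter_upwards [h0 x hx] with y hy
    simp [hy]

theorem ContDiffOn.exists_contDiff_eq_near {n : ℕ} {k : ℕ∞} {U S : Set (Euc n)}
    {u : Euc n → ℝ} (hU : IsOpen U) (hS : IsClosed S) (hSU : S ⊆ U) (hu : ContDiffOn ℝ k u U) :
    ∃ w : Euc n → ℝ, ContDiff ℝ k w ∧ ∀ x ∈ S, w =ᶠ[𝓝 x] u := by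
  obtain ⟨θ, hθ, h0, h1⟩ := exists_contDiff_eq_zero_eq_one_near hU.isClosed_compl hS
    (disjoint_compl_left_iff_subset.2 hSU)
  refine ⟨_, hu.contDiff_mul_of_eq_zero_near hU hθ h0, fun x hx => ?_⟩
  filter_upwards [h1 x hx] with y hy
  simp [hy]

/-- A radial bump supported in the closed unit ball. -/
def radialBump (y : Euc 3) : ℝ := Real.smoothTransition (1 - ‖y‖ ^ 2)

/-- The radial kernel `m` with `∇ radialBump y = - m y • y`; averages against it have the mean
value property for harmonic functions. -/
def meanKernel (y : Euc 3) : ℝ := 2 * deriv Real.smoothTransition (1 - ‖y‖ ^ 2)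

theorem contDiff_radialBump : ContDiff ℝ ∞ radialBump :=
  Real.smoothTransition.contDiff.comp (contDiff_const.sub (contDiff_norm_sq ℝ))

theorem contDiff_meanKernel : ContDiff ℝ ∞ meanKernel := by
  have h : ContDiff ℝ ∞ (deriv Real.smoothTransition) :=
    (contDiff_infty_iff_deriv.1 (Real.smoothTransition.contDiff (n := ⊤))).2
  exact contDiff_const.mul (h.comp (contDiff_const.sub (contDiff_norm_sq ℝ)))

theorem radialBump_eq_zero {y : Euc 3} (hy : 1 ≤ ‖y‖) : radialBump y = 0 :=
  Real.smoothTransition.zero_of_nonpos (by nlinarith)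

theorem meanKernel_eq_zero {y : Euc 3} (hy : 1 ≤ ‖y‖) : meanKernel y = 0 := by
  have h : IsLocalMin Real.smoothTransition (1 - ‖y‖ ^ 2) := by
    refine Eventually.of_forall fun z => ?_
    rw [Real.smoothTransition.zero_of_nonpos (show 1 - ‖y‖ ^ 2 ≤ 0 by nlinarith)]
    exact Real.smoothTransition.nonneg z
  simp [meanKernel, h.deriv_eq_zero]

theorem hasCompactSupport_radialBump : HasCompactSupport radialBump :=
  HasCompactSupport.intro (isCompact_closedBall 0 1) fun y hy => radialBump_eq_zero (by
    simp at hy; exact hy.le)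

theorem hasCompactSupport_meanKernel : HasCompactSupport meanKernel :=
  HasCompactSupport.intro (isCompact_closedBall 0 1) fun y hy => meanKernel_eq_zero (by
    simp at hy; exact hy.le)

theorem integrable_meanKernel : Integrable meanKernel :=
  contDiff_meanKernel.continuous.integrable_of_hasCompactSupport hasCompactSupport_meanKernel

theorem meanKernel_nonneg (y : Euc 3) : 0 ≤ meanKernel y :=
  mul_nonneg zero_le_two Real.smoothTransition.monotone.deriv_nonneg

theorem pderiv_norm_sq {n : ℕ} (i : Fin n) (y : Euc n) :
    pderiv i (fun y : Euc n => ‖y‖ ^ 2) y = 2 * y i := by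
  have := (hasStrictFDerivAt_norm_sq y).hasFDerivAt.fderiv
  simp only [pderiv]
  rw [this]
  simp [EuclideanSpace.inner_single_right]

theorem pderiv_scomp {n : ℕ} {g : ℝ → ℝ} {f : Euc n → ℝ} {y : Euc n} (i : Fin n)
    (hg : DifferentiableAt ℝ g (f y)) (hf : DifferentiableAt ℝ f y) :
    pderiv i (fun y => g (f y)) y = deriv g (f y) * pderiv i f y := by
  have := (hg.hasDerivAt.comp_hasFDerivAt y hf.hasFDerivAt).fderiv
  simp only [pderiv]
  rw [show (fun y => g (f y)) = g ∘ f from rfl, this]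
  simp

theorem pderiv_radialBump (i : Fin 3) (y : Euc 3) :
    pderiv i radialBump y = - (y i * meanKernel y) := by
  have hd : DifferentiableAt ℝ (fun y : Euc 3 => ‖y‖ ^ 2) y :=
    (contDiff_norm_sq ℝ (n := 1)).differentiable (by simp) y
  have h1 := pderiv_scomp (g := fun s => Real.smoothTransition (1 - s)) (y := y) i
    (f := fun y => ‖y‖ ^ 2)
    (((Real.smoothTransition.contDiff (n := 1)).comp
      (contDiff_const.sub contDiff_id)).differentiable (by simp) _) hd
  have h2 : deriv (fun s => Real.smoothTransition (1 - s)) (‖y‖ ^ 2)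
      = - deriv Real.smoothTransition (1 - ‖y‖ ^ 2) := deriv_comp_const_sub _ _ _
  rw [pderiv_norm_sq, h2] at h1
  rw [show radialBump = fun y => Real.smoothTransition (1 - ‖y‖ ^ 2) from rfl, h1, meanKernel]
  ring

theorem integral_radialBump_pos : 0 < ∫ y, radialBump y := by
  refine contDiff_radialBump.continuous.integral_pos_of_hasCompactSupport_nonneg_nonzero
    hasCompactSupport_radialBump (fun y => Real.smoothTransition.nonneg _) (x := 0) ?_
  simp [radialBump]

theorem integral_meanKernel_pos : 0 < ∫ y, meanKernel y := by
  have hex : ∃ y, meanKernel y ≠ 0 := by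
    by_contra! h
    have hz : ∀ y : Euc 3, fderiv ℝ radialBump y = 0 := fun y => by
      ext b
      rw [fderiv_eq_sum_pderiv]
      simp [pderiv_radialBump, h]
    have := is_const_of_fderiv_eq_zero (contDiff_radialBump.differentiable (by simp)) hz 0
      (EuclideanSpace.single 0 1)
    rw [radialBump_eq_zero (y := EuclideanSpace.single 0 1) (by simp)] at this
    simp [radialBump] at this
  obtain ⟨y, hy⟩ := hex
  exact contDiff_meanKernel.continuous.integral_pos_of_hasCompactSupport_nonneg_nonzero
    hasCompactSupport_meanKernel meanKernel_nonneg hy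

theorem pderiv_comp_add_smul {n : ℕ} {u : Euc n → ℝ} (hu : Differentiable ℝ u) (x : Euc n)
    (r : ℝ) (i : Fin n) (y : Euc n) :
    pderiv i (fun y => u (x + r • y)) y = r * pderiv i u (x + r • y) := by
  have h1 : HasFDerivAt (fun y : Euc n => x + r • y) (r • ContinuousLinearMap.id ℝ (Euc n)) y :=
    ((hasFDerivAt_id y).const_smul r).const_add x
  have := ((hu (x + r • y)).hasFDerivAt.comp y h1).fderiv
  simp only [pderiv]
  rw [show (fun y => u (x + r • y)) = u ∘ (fun y => x + r • y) from rfl, this]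
  simp

theorem lap_comp_add_smul {n : ℕ} {u : Euc n → ℝ} (hu : ContDiff ℝ 2 u) (x : Euc n)
    (r : ℝ) (y : Euc n) :
    lap (fun y => u (x + r • y)) y = r ^ 2 * lap u (x + r • y) := by
  simp only [lap, Finset.mul_sum]
  refine Finset.sum_congr rfl fun i _ => ?_
  have h1 : pderiv i (fun y => u (x + r • y)) = fun y => r * pderiv i u (x + r • y) :=
    funext fun y => pderiv_comp_add_smul (hu.differentiable (by simp)) x r i y
  have h2 : ContDiff ℝ 1 (pderiv i u) := hu.pderiv i (by norm_num)
  have h3 : Differentiable ℝ (fun y => pderiv i u (x + r • y)) :=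
    (h2.differentiable (by simp)).comp (by fun_prop : Differentiable ℝ fun y : Euc n => x + r • y)
  rw [h1, pderiv_const_mul r (h3 y), pderiv_comp_add_smul (h2.differentiable (by simp))]
  ring

theorem hasDerivAt_integral_meanKernel {u : Euc 3 → ℝ} (hu : ContDiff ℝ 1 u) (x : Euc 3)
    (r : ℝ) :
    HasDerivAt (fun r => ∫ y, meanKernel y * u (x + r • y))
      (- ∫ y, ∑ i, pderiv i radialBump y * pderiv i u (x + r • y)) r := by
  have hmk := contDiff_meanKernel.continuous
  have hu' := hu.continuous_fderiv (by simp)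
  set F' : ℝ → Euc 3 → ℝ := fun r y => meanKernel y * fderiv ℝ u (x + r • y) y with hF'
  have hcont : Continuous fun p : ℝ × Euc 3 => F' p.1 p.2 := by
    simp only [hF']
    fun_prop
  obtain ⟨C, hC⟩ := ((isCompact_closedBall r (1 : ℝ)).prod
    (isCompact_closedBall (0 : Euc 3) 1)).exists_bound_of_continuousOn hcont.continuousOn
  have hF'eq : (- ∫ y, ∑ i, pderiv i radialBump y * pderiv i u (x + r • y)) = ∫ y, F' r y := by
    rw [← integral_neg]
    refine integral_congr_ae (Eventually.of_forall fun y => ?_)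
    simp only [hF', fderiv_eq_sum_pderiv, pderiv_radialBump, Finset.mul_sum,
      ← Finset.sum_neg_distrib]
    exact Finset.sum_congr rfl fun i _ => by ring
  rw [hF'eq]
  refine (hasDerivAt_integral_of_dominated_loc_of_deriv_le
    (bound := (Metric.closedBall (0 : Euc 3) 1).indicator fun _ => C)
    (s := Metric.ball r 1) (F := fun r y => meanKernel y * u (x + r • y)) (F' := F')
    (Metric.ball_mem_nhds r one_pos)
    (Eventually.of_forall fun r => ?_) ?_ ?_ ?_ ?_ ?_).2
  · have := hu.continuous
    exact (by fun_prop : Continuous fun y => meanKernel y * u (x + r • y)).aestronglyMeasurable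
  · have := hu.continuous
    exact (by fun_prop : Continuous fun y => meanKernel y * u (x + r • y)
      ).integrable_of_hasCompactSupport hasCompactSupport_meanKernel.mul_right
  · exact (hcont.comp (Continuous.prodMk_right r)).aestronglyMeasurable
  · refine Eventually.of_forall fun y r' hr' => ?_
    by_cases hy : y ∈ Metric.closedBall (0 : Euc 3) 1
    · rw [indicator_of_mem hy]
      exact hC (r', y) ⟨Metric.ball_subset_closedBall hr', hy⟩
    · rw [indicator_of_notMem hy]
      simp only [Metric.mem_closedBall, dist_zero_right, not_le] at hy
      simp [hF', meanKernel_eq_zero hy.le]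
  · exact (integrable_indicator_iff measurableSet_closedBall).2
      (integrableOn_const (measure_closedBall_lt_top.ne))
  · refine Eventually.of_forall fun y r' _ => ?_
    have h1 : HasDerivAt (fun r : ℝ => x + r • y) y r' := by
      simpa using ((hasDerivAt_id r').smul_const y).const_add x
    have h2 : HasFDerivAt u (fderiv ℝ u (x + r' • y)) (x + r' • y) :=
      (hu.differentiable (by simp) _).hasFDerivAt
    exact (h2.comp_hasDerivAt r' h1).const_mul (meanKernel y)

theorem integral_meanKernel_eq_of_weakly_harmonic {u : Euc 3 → ℝ} (hu : ContDiff ℝ 1 u)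
    {x : Euc 3} {R : ℝ} (hR : 0 < R)
    (h : ∀ r ∈ Ioo 0 R, ∫ y, ∑ i, pderiv i radialBump y * pderiv i u (x + r • y) = 0) :
    ∫ y, meanKernel y * u (x + R • y) = (∫ y, meanKernel y) * u x := by
  obtain ⟨c, hc, hc'⟩ := exists_hasDerivAt_eq_slope (fun r => ∫ y, meanKernel y * u (x + r • y))
    _ hR (fun r _ => (hasDerivAt_integral_meanKernel hu x r).continuousAt.continuousWithinAt)
    (fun r _ => hasDerivAt_integral_meanKernel hu x r)
  rw [h c hc, neg_zero, eq_comm, div_eq_zero_iff, or_iff_left (by linarith)] at hc'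
  simp only [zero_smul, add_zero, integral_mul_const] at hc'
  linarith

theorem two_le_infty : (2 : ℕ∞ω) ≤ ∞ := WithTop.coe_le_coe.2 (le_top : (2 : ℕ∞) ≤ ⊤)

theorem contDiff_integral_mul_sub {f g : Euc 3 → ℝ} (hf : LocallyIntegrable f)
    (hg : ContDiff ℝ ∞ g) (hc : HasCompactSupport g) :
    ContDiff ℝ ∞ (fun x => ∫ t, f t * g (x - t)) :=
  hc.contDiff_convolution_right (ContinuousLinearMap.mul ℝ ℝ) hf hg

theorem pderiv_integral_mul_sub {f g : Euc 3 → ℝ} (hf : LocallyIntegrable f)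
    (hg : ContDiff ℝ ∞ g) (hc : HasCompactSupport g) (i : Fin 3) (x : Euc 3) :
    pderiv i (fun x => ∫ t, f t * g (x - t)) x = ∫ t, f t * pderiv i g (x - t) := by
  have h1 : ContDiff ℝ 1 g := hg.of_le (by exact_mod_cast le_top)
  have h := (hc.hasFDerivAt_convolution_right (ContinuousLinearMap.mul ℝ ℝ) hf h1 x).fderiv
  change fderiv ℝ (convolution f g (ContinuousLinearMap.mul ℝ ℝ) volume) x _ = _
  rw [h, convolution_precompR_apply _ hf (hc.fderiv ℝ) (h1.continuous_fderiv (by simp))]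
  rfl

theorem lap_integral_mul_sub {f g : Euc 3 → ℝ} (hf : LocallyIntegrable f)
    (hg : ContDiff ℝ ∞ g) (hc : HasCompactSupport g) (x : Euc 3) :
    lap (fun x => ∫ t, f t * g (x - t)) x = ∫ t, f t * lap g (x - t) := by
  have hg1 : ∀ i, ContDiff ℝ ∞ (pderiv i g) := fun i => hg.pderiv i (by simp)
  have hg2 : ∀ i, ContDiff ℝ ∞ (pderiv i (pderiv i g)) := fun i => (hg1 i).pderiv i (by simp)
  simp only [lap, Finset.mul_sum]
  rw [integral_finsetSum]
  · refine Finset.sum_congr rfl fun i _ => ?_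
    rw [show pderiv i (fun x => ∫ t, f t * g (x - t)) = fun x => ∫ t, f t * pderiv i g (x - t)
      from funext fun x => pderiv_integral_mul_sub hf hg hc i x,
      pderiv_integral_mul_sub hf (hg1 i) (hc.pderiv i)]
  · intro i _
    exact ((hc.pderiv i).pderiv i).convolutionExists_right (ContinuousLinearMap.mul ℝ ℝ) hf
      (hg2 i).continuous x

/-- The mean value property on `U`, with respect to the averages against `meanKernel`. -/
def HasMeanValue (U : Set (Euc 3)) (u : Euc 3 → ℝ) : Prop :=
  ContinuousOn u U ∧ ∀ x r, 0 < r → Metric.closedBall x r ⊆ U →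
    ∫ y, meanKernel y * u (x + r • y) = (∫ y, meanKernel y) * u x

theorem add_smul_mem_closedBall {x y : Euc 3} {r : ℝ} (hr : 0 ≤ r) (hy : ‖y‖ ≤ 1) :
    x + r • y ∈ Metric.closedBall x r := by
  simp only [Metric.mem_closedBall, dist_self_add_left, norm_smul, Real.norm_eq_abs,
    abs_of_nonneg hr]
  nlinarith

theorem integral_meanKernel_mul_congr {u w : Euc 3 → ℝ} {x : Euc 3} {r : ℝ} (hr : 0 ≤ r)
    (h : ∀ z ∈ Metric.closedBall x r, u z = w z) :
    ∫ y, meanKernel y * u (x + r • y) = ∫ y, meanKernel y * w (x + r • y) := by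
  refine integral_congr_ae (Eventually.of_forall fun y => ?_)
  rcases le_total 1 ‖y‖ with hy | hy
  · simp [meanKernel_eq_zero hy]
  · simp only [h _ (add_smul_mem_closedBall hr hy)]

theorem pderiv_radialBump_eq_zero {y : Euc 3} (hy : 1 ≤ ‖y‖) (i : Fin 3) :
    pderiv i radialBump y = 0 := by
  simp [pderiv_radialBump, meanKernel_eq_zero hy]

theorem integral_pderiv_radialBump_eq {u : Euc 3 → ℝ} (hu : ContDiff ℝ 2 u) (x : Euc 3)
    {r : ℝ} (hr : 0 < r) :
    ∫ y, ∑ i, pderiv i radialBump y * pderiv i u (x + r • y)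
      = - (r * ∫ y, radialBump y * lap u (x + r • y)) := by
  have hg : ContDiff ℝ 2 (fun y => u (x + r • y)) := hu.comp (by fun_prop)
  have h := integral_mul_lap_eq (contDiff_radialBump.of_le two_le_infty) hg
    hasCompactSupport_radialBump
  simp only [lap_comp_add_smul hu, pderiv_comp_add_smul (hu.differentiable (by simp))] at h
  have h1 : ∀ y, radialBump y * (r ^ 2 * lap u (x + r • y))
    = r ^ 2 * (radialBump y * lap u (x + r • y)) := fun y => by ring
  have h2 : ∀ y, ∑ i, pderiv i radialBump y * (r * pderiv i u (x + r • y))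
    = r * ∑ i, pderiv i radialBump y * pderiv i u (x + r • y) := fun y => by
      rw [Finset.mul_sum]; exact Finset.sum_congr rfl fun i _ => by ring
  simp only [h1, h2, integral_const_mul] at h
  have hr' := hr.ne'
  apply mul_left_cancel₀ hr'
  linarith

theorem hasMeanValue_of_lap_eq_zero {U : Set (Euc 3)} {u : Euc 3 → ℝ} (hU : IsOpen U)
    (hu : ContDiffOn ℝ 2 u U) (hl : ∀ x ∈ U, lap u x = 0) : HasMeanValue U u := by
  refine ⟨hu.continuousOn, fun x r hr hx => ?_⟩
  obtain ⟨w, hw, hwu⟩ := ContDiffOn.exists_contDiff_eq_near (k := 2) hU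
    Metric.isClosed_closedBall hx hu
  rw [integral_meanKernel_mul_congr hr.le fun z hz => (hwu z hz).eq_of_nhds.symm,
    ← (hwu x (Metric.mem_closedBall_self hr.le)).eq_of_nhds]
  refine integral_meanKernel_eq_of_weakly_harmonic (hw.of_le (by norm_num)) hr fun s hs => ?_
  have hw2 : ContDiff ℝ 2 w := hw
  rw [integral_pderiv_radialBump_eq hw2 x hs.1]
  have : ∀ y, radialBump y * lap w (x + s • y) = 0 := fun y => by
    rcases le_total 1 ‖y‖ with hy | hy
    · simp [radialBump_eq_zero hy]
    · have hm : x + s • y ∈ Metric.closedBall x r :=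
        Metric.closedBall_subset_closedBall hs.2.le (add_smul_mem_closedBall hs.1.le hy)
      rw [(hwu _ hm).lap_eq, hl _ (hx hm), mul_zero]
  simp [this]

theorem hasMeanValue_of_curl_div_eq_zero {U : Set (Euc 3)} {u : Euc 3 → Fin 3 → ℝ}
    (hU : IsOpen U) (hu : ∀ i, ContDiffOn ℝ 1 (fun x => u x i) U)
    (hcurl : ∀ x ∈ U, ∀ i j, pderiv i (fun y => u y j) x = pderiv j (fun y => u y i) x)
    (hdiv : ∀ x ∈ U, ∑ i, pderiv i (fun y => u y i) x = 0) (i : Fin 3) :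
    HasMeanValue U (fun x => u x i) := by
  refine ⟨(hu i).continuousOn, fun x r hr hx => ?_⟩
  choose w hw hwu using fun i => ContDiffOn.exists_contDiff_eq_near (k := 1) hU
    Metric.isClosed_closedBall hx (hu i)
  have hw1 : ∀ i, ContDiff ℝ 1 (w i) := hw
  rw [integral_meanKernel_mul_congr hr.le fun z hz => (hwu i z hz).eq_of_nhds.symm,
    ← show w i x = (fun x => u x i) x from
      (hwu i x (Metric.mem_closedBall_self hr.le)).eq_of_nhds]
  refine integral_meanKernel_eq_of_weakly_harmonic (hw1 i) hr fun s hs => ?_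
  set g : Fin 3 → Euc 3 → ℝ := fun j y => w j (x + s • y) with hg
  have hgc : ∀ j, ContDiff ℝ 1 (g j) := fun j => (hw1 j).comp (by fun_prop)
  have hgp : ∀ a j y, pderiv a (g j) y = s * pderiv a (w j) (x + s • y) := fun a j y =>
    pderiv_comp_add_smul ((hw1 j).differentiable (by simp)) x s a y
  have hmem : ∀ y : Euc 3, ‖y‖ ≤ 1 → x + s • y ∈ Metric.closedBall x r := fun y hy =>
    Metric.closedBall_subset_closedBall hs.2.le (add_smul_mem_closedBall hs.1.le hy)
  have hcg : ∀ y : Euc 3, ‖y‖ ≤ 1 → ∀ a j, pderiv a (g j) y = pderiv j (g a) y := by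
    intro y hy a j
    rw [hgp, hgp, ((hwu j _ (hmem y hy)).pderiv a).eq_of_nhds,
      ((hwu a _ (hmem y hy)).pderiv j).eq_of_nhds, hcurl _ (hx (hmem y hy))]
  have hdg : ∀ y : Euc 3, ‖y‖ ≤ 1 → ∑ j, pderiv j (g j) y = 0 := by
    intro y hy
    simp only [hgp, ← Finset.mul_sum]
    rw [Finset.sum_congr rfl fun j _ => ((hwu j _ (hmem y hy)).pderiv j).eq_of_nhds,
      hdiv _ (hx (hmem y hy)), mul_zero]
  have hk : ∀ j, ContDiff ℝ ∞ (pderiv j radialBump) := fun j =>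
    contDiff_radialBump.pderiv j (by simp)
  have hk1 : ∀ j, ContDiff ℝ 1 (pderiv j radialBump) := fun j =>
    (hk j).of_le (by exact_mod_cast le_top)
  have hkc : ∀ j, HasCompactSupport (pderiv j radialBump) := fun j =>
    hasCompactSupport_radialBump.pderiv j
  have hInt : ∀ a b j, Integrable fun y => pderiv a radialBump y * pderiv b (g j) y := by
    intro a b j
    exact ((hk a).continuous.mul
      ((hgc j).pderiv b (m := 0) (by simp)).continuous).integrable_of_hasCompactSupport
      (hkc a).mul_right
  have key : ∀ j, ∫ y, pderiv j radialBump y * pderiv i (g j) y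
      = ∫ y, pderiv i radialBump y * pderiv j (g j) y := by
    intro j
    rw [integral_mul_pderiv_eq_neg (hk1 j) (hgc j) (hkc j) i,
      integral_mul_pderiv_eq_neg (hk1 i) (hgc j) (hkc i) j]
    refine congrArg Neg.neg (integral_congr_ae (Eventually.of_forall fun y => ?_))
    simp only
    rw [pderiv_comm (contDiff_radialBump.contDiffAt.of_le two_le_infty)]
  have hz : ∫ y, ∑ j, pderiv j radialBump y * pderiv j (g i) y = 0 := by
    have h1 : ∀ y, ∑ j, pderiv j radialBump y * pderiv j (g i) y
        = ∑ j, pderiv j radialBump y * pderiv i (g j) y := by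
      intro y
      refine Finset.sum_congr rfl fun j _ => ?_
      rcases le_total 1 ‖y‖ with hy | hy
      · simp [pderiv_radialBump_eq_zero hy]
      · rw [hcg y hy]
    simp only [h1]
    rw [integral_finsetSum _ fun j _ => hInt j i j, Finset.sum_congr rfl fun j _ => key j,
      ← integral_finsetSum _ fun j _ => hInt i j j]
    refine integral_eq_zero_of_ae (Eventually.of_forall fun y => ?_)
    simp only [← Finset.mul_sum, Pi.zero_apply]
    rcases le_total 1 ‖y‖ with hy | hy
    · simp [pderiv_radialBump_eq_zero hy]
    · rw [hdg y hy, mul_zero]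
  have h2 : ∀ y, ∑ j, pderiv j radialBump y * pderiv j (g i) y
      = s * ∑ j, pderiv j radialBump y * pderiv j (w i) (x + s • y) := fun y => by
    rw [Finset.mul_sum]
    exact Finset.sum_congr rfl fun j _ => by rw [hgp]; ring
  simp only [h2, integral_const_mul] at hz
  exact (mul_eq_zero.1 hz).resolve_left hs.1.ne'

theorem meanKernel_neg (y : Euc 3) : meanKernel (-y) = meanKernel y := by simp [meanKernel]

theorem HasMeanValue.eq_integral {U : Set (Euc 3)} {u : Euc 3 → ℝ} (h : HasMeanValue U u)
    {x₀ x : Euc 3} {r : ℝ} (hr : 0 < r) (hx₀ : Metric.closedBall x₀ (2 * r) ⊆ U)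
    (hx : x ∈ Metric.ball x₀ r) :
    u x = ((∫ y, meanKernel y)⁻¹ * (r ^ 3)⁻¹) *
      ∫ t, (Metric.closedBall x₀ (2 * r)).indicator u t * meanKernel (r⁻¹ • (x - t)) := by
  have hsub : Metric.closedBall x r ⊆ Metric.closedBall x₀ (2 * r) :=
    Metric.closedBall_subset_closedBall' (by rw [Metric.mem_ball] at hx; linarith)
  have h1 := h.2 x r hr (hsub.trans hx₀)
  rw [integral_meanKernel_mul_congr hr.le
    (w := (Metric.closedBall x₀ (2 * r)).indicator u)
    fun z hz => (indicator_of_mem (hsub hz) u).symm] at h1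
  set v := (Metric.closedBall x₀ (2 * r)).indicator u
  have h2 := Measure.integral_comp_smul (volume : Measure (Euc 3))
    (fun z => v (x + z) * meanKernel (r⁻¹ • (- z))) r
  have h3 : ∀ y : Euc 3, meanKernel (r⁻¹ • (- (r • y))) = meanKernel y := fun y => by
    rw [smul_neg, inv_smul_smul₀ hr.ne', meanKernel_neg]
  have h4 := integral_sub_right_eq_self (μ := (volume : Measure (Euc 3)))
    (fun z => v (x + z) * meanKernel (r⁻¹ • (- z))) x
  simp only [add_sub_cancel, neg_sub] at h4
  simp only [h3, finrank_euclideanSpace, Fintype.card_fin, smul_eq_mul,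
    abs_of_pos (inv_pos.2 (pow_pos hr 3))] at h2
  rw [h4, mul_assoc, ← h2, eq_inv_mul_iff_mul_eq₀ integral_meanKernel_pos.ne', ← h1]
  simp only [mul_comm]

theorem contDiff_meanKernel_smul (r : ℝ) : ContDiff ℝ ∞ fun y => meanKernel (r • y) :=
  contDiff_meanKernel.comp (by fun_prop)

theorem hasCompactSupport_meanKernel_smul {r : ℝ} (hr : r ≠ 0) :
    HasCompactSupport fun y => meanKernel (r • y) :=
  hasCompactSupport_meanKernel.comp_smul hr

theorem ContinuousOn.locallyIntegrable_indicator {u : Euc 3 → ℝ} {x₀ : Euc 3} {r : ℝ}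
    (h : ContinuousOn u (Metric.closedBall x₀ r)) :
    LocallyIntegrable ((Metric.closedBall x₀ r).indicator u) :=
  ((integrable_indicator_iff measurableSet_closedBall).2
    (h.integrableOn_compact (isCompact_closedBall _ _))).locallyIntegrable

theorem HasMeanValue.contDiffOn {U : Set (Euc 3)} {u : Euc 3 → ℝ} (hU : IsOpen U)
    (h : HasMeanValue U u) : ContDiffOn ℝ ∞ u U := by
  intro x hx
  obtain ⟨r, hr, hrU⟩ := Metric.nhds_basis_closedBall.mem_iff.1 (hU.mem_nhds hx)
  have hr2 : Metric.closedBall x (2 * (r / 2)) ⊆ U := by rwa [mul_div_cancel₀ _ two_ne_zero]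
  refine ContDiffAt.contDiffWithinAt ?_
  have hc := contDiff_integral_mul_sub (h.1.mono hr2).locallyIntegrable_indicator
    (contDiff_meanKernel_smul (r / 2)⁻¹) (hasCompactSupport_meanKernel_smul (by positivity))
  refine (contDiff_const (c := (∫ y, meanKernel y)⁻¹ * ((r / 2) ^ 3)⁻¹)
    |>.mul hc).contDiffAt.congr_of_eventuallyEq ?_
  filter_upwards [Metric.ball_mem_nhds x (half_pos hr)] with y hy
  exact h.eq_integral (half_pos hr) hr2 hy

theorem HasMeanValue.lap_eq_zero {U : Set (Euc 3)} {u : Euc 3 → ℝ} (hU : IsOpen U)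
    (h : HasMeanValue U u) {x : Euc 3} (hx : x ∈ U) : lap u x = 0 := by
  obtain ⟨r, hr, hrU⟩ := Metric.nhds_basis_closedBall.mem_iff.1 (hU.mem_nhds hx)
  obtain ⟨w, hw, hwu⟩ := ContDiffOn.exists_contDiff_eq_near (k := ⊤) hU
    Metric.isClosed_closedBall hrU (h.contDiffOn hU)
  have hw2 : ContDiff ℝ 2 w := hw.of_le two_le_infty
  have hlc : Continuous (lap w) := by
    refine continuous_finsetSum _ fun i _ => ?_
    exact ((hw2.pderiv i (m := 1) (by norm_num)).pderiv i (m := 0) (by simp)).continuous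
  have hzero : ∀ s ∈ Ioo 0 r, ∫ y, radialBump y * lap w (x + s • y) = 0 := by
    intro s hs
    have hconst : (fun s => ∫ y, meanKernel y * w (x + s • y)) =ᶠ[𝓝 s]
        fun _ => (∫ y, meanKernel y) * u x := by
      filter_upwards [Ioo_mem_nhds hs.1 hs.2] with t ht
      have htr := Metric.closedBall_subset_closedBall (x := x) ht.2.le
      rw [← h.2 x t ht.1 (htr.trans hrU)]
      exact integral_meanKernel_mul_congr ht.1.le fun z hz => (hwu z (htr hz)).eq_of_nhds
    have hd := (hasDerivAt_integral_meanKernel (hw2.of_le (by norm_num)) x s).unique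
      ((hasDerivAt_const s _).congr_of_eventuallyEq hconst)
    rw [integral_pderiv_radialBump_eq hw2 x hs.1, neg_neg] at hd
    exact (mul_eq_zero.1 hd).resolve_left hs.1.ne'
  obtain ⟨C, hC⟩ := (isCompact_closedBall x r).exists_bound_of_continuousOn hlc.continuousOn
  have hlim : Tendsto (fun s : ℝ => ∫ y, radialBump y * lap w (x + s • y)) (𝓝[>] 0)
      (𝓝 (∫ y, radialBump y * lap w x)) := by
    have hbc := contDiff_radialBump.continuous
    refine tendsto_integral_filter_of_dominated_convergence (fun y => C * radialBump y) ?_ ?_ ?_ ?_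
    · exact Eventually.of_forall fun s => (by fun_prop : Continuous fun y =>
        radialBump y * lap w (x + s • y)).aestronglyMeasurable
    · filter_upwards [Ioo_mem_nhdsGT hr] with s hs
      refine Eventually.of_forall fun y => ?_
      rcases le_total 1 ‖y‖ with hy | hy
      · simp [radialBump_eq_zero hy]
      · have h0 : 0 ≤ radialBump y := Real.smoothTransition.nonneg _
        rw [norm_mul, Real.norm_of_nonneg h0, mul_comm]
        exact mul_le_mul_of_nonneg_right (hC _ (Metric.closedBall_subset_closedBall hs.2.le
          (add_smul_mem_closedBall hs.1.le hy))) h0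
    · exact (hbc.integrable_of_hasCompactSupport hasCompactSupport_radialBump).const_mul C
    · refine Eventually.of_forall fun y => ?_
      have : Continuous fun s : ℝ => radialBump y * lap w (x + s • y) := by fun_prop
      simpa using (this.tendsto 0).mono_left nhdsWithin_le_nhds
  have hlim0 : ∫ y, radialBump y * lap w x = 0 := by
    refine tendsto_nhds_unique hlim (tendsto_const_nhds.congr' ?_)
    filter_upwards [Ioo_mem_nhdsGT hr] with s hs
    exact (hzero s hs).symm
  rw [integral_mul_const] at hlim0
  rw [← (hwu x (Metric.mem_closedBall_self hr.le)).lap_eq]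
  exact (mul_eq_zero.1 hlim0).resolve_left integral_radialBump_pos.ne'

theorem HasMeanValue.exists_abs_pderiv_le :
    ∃ C : ℝ, ∀ (U : Set (Euc 3)) (u : Euc 3 → ℝ), HasMeanValue U u → ∀ (x : Euc 3) (ε : ℝ),
      Metric.closedBall x 2 ⊆ U → (∀ z ∈ Metric.closedBall x 2, |u z| ≤ ε) →
      ∀ i, |pderiv i u x| ≤ C * ε := by
  set M : Euc 3 → ℝ := fun y => meanKernel ((1 : ℝ)⁻¹ • y) with hM
  have hMs : ContDiff ℝ ∞ M := contDiff_meanKernel_smul _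
  have hMc : HasCompactSupport M := hasCompactSupport_meanKernel_smul (by norm_num)
  set c := (∫ y, meanKernel y)⁻¹ * ((1 : ℝ) ^ 3)⁻¹ with hc
  have hc0 : 0 ≤ c := by have := integral_meanKernel_pos; positivity
  have hInt : ∀ i, Integrable (pderiv i M) := fun i =>
    (hMs.pderiv i (m := ∞) (by simp)).continuous.integrable_of_hasCompactSupport (hMc.pderiv i)
  refine ⟨c * ∑ i, ∫ y, |pderiv i M y|, fun U u hu x ε hx hε i => ?_⟩
  have hε0 : 0 ≤ ε := (abs_nonneg _).trans (hε x (Metric.mem_closedBall_self (by norm_num)))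
  have hx' : Metric.closedBall x (2 * 1) ⊆ U := by rwa [mul_one]
  have hli := (hu.1.mono hx').locallyIntegrable_indicator
  have hev : u =ᶠ[𝓝 x] fun y => c *
      ∫ t, (Metric.closedBall x (2 * 1)).indicator u t * M (y - t) := by
    filter_upwards [Metric.ball_mem_nhds x one_pos] with y hy
    exact hu.eq_integral one_pos hx' hy
  rw [(hev.pderiv i).eq_of_nhds, pderiv_const_mul c
    ((contDiff_integral_mul_sub hli hMs hMc).differentiable (by simp) x),
    pderiv_integral_mul_sub hli hMs hMc, abs_mul, abs_of_nonneg hc0, mul_assoc c]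
  refine mul_le_mul_of_nonneg_left ?_ hc0
  have h1 : |∫ t, (Metric.closedBall x (2 * 1)).indicator u t * pderiv i M (x - t)|
      ≤ ∫ t, |pderiv i M (x - t)| * ε := by
    refine norm_integral_le_of_norm_le (f := fun t =>
      (Metric.closedBall x (2 * 1)).indicator u t * pderiv i M (x - t))
      (((hInt i).comp_sub_left x).abs.mul_const ε) (Eventually.of_forall fun t => ?_)
    rw [norm_mul, mul_comm, Real.norm_eq_abs, Real.norm_eq_abs]
    refine mul_le_mul_of_nonneg_left ?_ (abs_nonneg _)
    by_cases ht : t ∈ Metric.closedBall x (2 * 1)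
    · rw [indicator_of_mem ht]
      exact hε t (by rwa [mul_one] at ht)
    · rw [indicator_of_notMem ht]; simpa
  rw [integral_mul_const, integral_sub_left_eq_self (fun t => |pderiv i M t|)] at h1
  refine h1.trans (mul_le_mul_of_nonneg_right ?_ hε0)
  exact Finset.single_le_sum (f := fun i => ∫ y, |pderiv i M y|)
    (fun j _ => integral_nonneg fun y => abs_nonneg _) (Finset.mem_univ i)

/-- The gradient of a harmonic function on an exterior domain vanishes at infinity if the
function does. -/
theorem HasMeanValue.tendsto_pderiv_cocompact {U : Set (Euc 3)} {u : Euc 3 → ℝ}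
    {ρ : ℝ} (hU : Uᶜ ⊆ Metric.closedBall 0 ρ) (h : HasMeanValue U u)
    (h0 : Tendsto u (cocompact (Euc 3)) (𝓝 0)) (i : Fin 3) :
    Tendsto (pderiv i u) (cocompact (Euc 3)) (𝓝 0) := by
  obtain ⟨C, hC⟩ := HasMeanValue.exists_abs_pderiv_le
  rw [Metric.tendsto_nhds]
  intro ε hε
  have hδ : 0 < ε / (|C| + 1) := by positivity
  have h1 := Metric.tendsto_nhds.1 h0 _ hδ
  obtain ⟨R, -, hR⟩ := (Metric.hasBasis_cobounded_compl_closedBall (0 : Euc 3)).eventually_iff.1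
    (Metric.cobounded_eq_cocompact (α := Euc 3) ▸ h1)
  rw [← Metric.cobounded_eq_cocompact]
  refine (Metric.hasBasis_cobounded_compl_closedBall (0 : Euc 3)).eventually_iff.2
    ⟨max R ρ + 2, trivial, fun x hx => ?_⟩
  have hfar : ∀ z ∈ Metric.closedBall x 2, max R ρ < ‖z‖ := fun z hz => by
    simp only [mem_compl_iff, Metric.mem_closedBall, dist_zero_right, not_le] at hx hz
    have : ‖x‖ ≤ ‖z‖ + 2 := by
      calc ‖x‖ = ‖z - (z - x)‖ := by simp
        _ ≤ ‖z‖ + ‖z - x‖ := norm_sub_le _ _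
        _ ≤ _ := by rw [dist_eq_norm] at hz; linarith
    linarith
  have h2 := hC U u h x (ε / (|C| + 1)) (fun z hz => by
    by_contra hzU
    have := hU hzU
    simp only [Metric.mem_closedBall, dist_zero_right] at this
    exact absurd ((le_max_right R ρ).trans_lt (hfar z hz)) (not_lt.2 this)) (fun z hz => by
      have hz' : z ∈ (Metric.closedBall (0 : Euc 3) R)ᶜ := by
        simpa using (le_max_left R ρ).trans_lt (hfar z hz)
      have := hR hz'
      rw [Real.dist_0_eq_abs] at this
      exact this.le) i
  rw [Real.dist_0_eq_abs]
  refine h2.trans_lt ?_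
  calc C * (ε / (|C| + 1)) ≤ |C| * (ε / (|C| + 1)) :=
        mul_le_mul_of_nonneg_right (le_abs_self C) hδ.le
    _ < (|C| + 1) * (ε / (|C| + 1)) := mul_lt_mul_of_pos_right (by linarith) hδ
    _ = ε := mul_div_cancel₀ _ (by positivity)

/-- Liouville's theorem for harmonic functions vanishing at infinity. -/
theorem HasMeanValue.eq_zero_of_tendsto {u : Euc 3 → ℝ} (h : HasMeanValue univ u)
    (h0 : Tendsto u (cocompact (Euc 3)) (𝓝 0)) (x : Euc 3) : u x = 0 := by
  have hcont : Continuous u := continuousOn_univ.1 h.1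
  obtain ⟨C, hC⟩ : ∃ C, ∀ z, ‖u z‖ ≤ C := by
    obtain ⟨S, hS, hS1⟩ := mem_cocompact.1 (h0 (Metric.ball_mem_nhds 0 one_pos))
    obtain ⟨C, hC⟩ := hS.exists_bound_of_continuousOn hcont.continuousOn
    refine ⟨max C 1, fun z => ?_⟩
    by_cases hz : z ∈ S
    · exact (hC z hz).trans (le_max_left _ _)
    · have := hS1 hz
      simp only [mem_preimage, Metric.mem_ball, dist_zero_right] at this
      exact this.le.trans (le_max_right _ _)
  have hmk := contDiff_meanKernel.continuous
  have hlim : Tendsto (fun r : ℝ => ∫ y, meanKernel y * u (x + r • y)) atTop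
      (𝓝 (∫ y : Euc 3, (0 : ℝ))) := by
    refine tendsto_integral_filter_of_dominated_convergence (fun y => C * meanKernel y) ?_ ?_ ?_ ?_
    · exact Eventually.of_forall fun r => (by fun_prop : Continuous fun y =>
        meanKernel y * u (x + r • y)).aestronglyMeasurable
    · refine Eventually.of_forall fun r => Eventually.of_forall fun y => ?_
      rw [norm_mul, Real.norm_of_nonneg (meanKernel_nonneg y), mul_comm]
      exact mul_le_mul_of_nonneg_right (hC _) (meanKernel_nonneg y)
    · exact integrable_meanKernel.const_mul C
    · have hne : ∀ᵐ y : Euc 3, y ≠ 0 := Measure.ae_ne volume 0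
      filter_upwards [hne] with y hy
      have h1 : Tendsto (fun r : ℝ => x + r • y) atTop (cocompact (Euc 3)) := by
        rw [← Metric.cobounded_eq_cocompact]
        refine tendsto_norm_atTop_iff_cobounded.1 ?_
        have h2 : Tendsto (fun r : ℝ => r * ‖y‖ - ‖x‖) atTop atTop :=
          tendsto_atTop_add_const_right _ _ (tendsto_id.atTop_mul_const (norm_pos_iff.2 hy))
        refine tendsto_atTop_mono' _ ?_ h2
        filter_upwards [eventually_ge_atTop 0] with r hr
        have := norm_sub_norm_le (r • y) (-x)
        rw [norm_smul, Real.norm_of_nonneg hr, norm_neg, sub_neg_eq_add, add_comm _ x] at this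
        exact this
      simpa using (h0.comp h1).const_mul (meanKernel y)
  have hconst : (∫ y, meanKernel y) * u x = 0 := by
    refine tendsto_nhds_unique (tendsto_const_nhds.congr' ?_) (by simpa using hlim)
    filter_upwards [eventually_gt_atTop 0] with r hr
    exact (h.2 x r hr (subset_univ _)).symm
  exact (mul_eq_zero.1 hconst).resolve_left integral_meanKernel_pos.ne'

theorem ContinuousOn.continuous_meanKernel_mul {U : Set (Euc 3)} {u : Euc 3 → ℝ} {x : Euc 3}
    {r : ℝ} (hU : IsOpen U) (hu : ContinuousOn u U) (hr : 0 < r)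
    (hx : Metric.closedBall x r ⊆ U) : Continuous fun y => meanKernel y * u (x + r • y) := by
  refine continuous_iff_continuousAt.2 fun y => ?_
  rcases le_or_gt ‖y‖ 1 with hy | hy
  · have h1 : ContinuousAt u (x + r • y) :=
      hu.continuousAt (hU.mem_nhds (hx (add_smul_mem_closedBall hr.le hy)))
    have h2 : ContinuousAt (fun y : Euc 3 => x + r • y) y := by fun_prop
    exact contDiff_meanKernel.continuous.continuousAt.mul
      (ContinuousAt.comp (f := fun y : Euc 3 => x + r • y) h1 h2)
  · refine (continuousAt_const (y := (0 : ℝ))).congr ?_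
    filter_upwards [continuous_norm.continuousAt.eventually (lt_mem_nhds hy)] with z hz
    simp [meanKernel_eq_zero hz.le]

/-- Uniform limits of harmonic functions are harmonic. -/
theorem HasMeanValue.of_tendstoUniformlyOn {U : Set (Euc 3)} {F : ℕ → Euc 3 → ℝ}
    {u : Euc 3 → ℝ} (hU : IsOpen U) (hF : ∀ n, HasMeanValue U (F n))
    (hlim : TendstoUniformlyOn F u atTop U) : HasMeanValue U u := by
  have hcont : ContinuousOn u U :=
    hlim.continuousOn (Eventually.of_forall fun n => (hF n).1).frequently
  refine ⟨hcont, fun x r hr hx => ?_⟩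
  obtain ⟨C, hC⟩ := (isCompact_closedBall x r).exists_bound_of_continuousOn (hcont.mono hx)
  have h1 : Tendsto (fun n => ∫ y, meanKernel y * F n (x + r • y)) atTop
      (𝓝 (∫ y, meanKernel y * u (x + r • y))) := by
    refine tendsto_integral_filter_of_dominated_convergence
      (fun y => (C + 1) * meanKernel y) ?_ ?_ (integrable_meanKernel.const_mul _) ?_
    · exact Eventually.of_forall fun n =>
        ((hF n).1.continuous_meanKernel_mul hU hr hx).aestronglyMeasurable
    · filter_upwards [Metric.tendstoUniformlyOn_iff.1 hlim 1 one_pos] with n hn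
      refine Eventually.of_forall fun y => ?_
      rcases le_total 1 ‖y‖ with hy | hy
      · simp [meanKernel_eq_zero hy]
      · have hm := add_smul_mem_closedBall (x := x) hr.le hy
        rw [norm_mul, Real.norm_of_nonneg (meanKernel_nonneg y), mul_comm]
        refine mul_le_mul_of_nonneg_right ?_ (meanKernel_nonneg y)
        have h2 := hn _ (hx hm)
        have h3 := hC _ hm
        rw [dist_comm, dist_eq_norm] at h2
        have h4 := norm_le_norm_add_norm_sub' (F n (x + r • y)) (u (x + r • y))
        linarith
    · refine Eventually.of_forall fun y => ?_
      rcases le_total 1 ‖y‖ with hy | hy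
      · simp [meanKernel_eq_zero hy]
      · exact (hlim.tendsto_at (hx (add_smul_mem_closedBall hr.le hy))).const_mul _
  refine tendsto_nhds_unique h1 ?_
  have hxU : x ∈ U := hx (Metric.mem_closedBall_self hr.le)
  simp only [(hF _).2 x r hr hx]
  exact (hlim.tendsto_at hxU).const_mul _

theorem integral_mul_lap_comm {n : ℕ} {f g : Euc n → ℝ} (hf : ContDiff ℝ 2 f)
    (hg : ContDiff ℝ 2 g) (hc : HasCompactSupport f) :
    ∫ x, f x * lap g x = ∫ x, lap f x * g x := by
  have hf' : ∀ i, ContDiff ℝ 1 (pderiv i f) := fun i => hf.pderiv i (by norm_num)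
  have hg' : ∀ i, ContDiff ℝ 1 (pderiv i g) := fun i => hg.pderiv i (by norm_num)
  have hf'' : ∀ i, ContDiff ℝ 0 (pderiv i (pderiv i f)) := fun i => (hf' i).pderiv i (by simp)
  rw [integral_mul_lap_eq hf hg hc]
  simp only [lap, Finset.sum_mul]
  rw [integral_finsetSum _ fun i _ => ?_, integral_finsetSum _ fun i _ => ?_,
    ← Finset.sum_neg_distrib]
  · refine Finset.sum_congr rfl fun i _ => ?_
    rw [integral_mul_pderiv_eq_neg (hf' i) (hg.of_le (by norm_num)) (hc.pderiv i), neg_neg]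
  · exact ((hf'' i).continuous.mul hg.continuous).integrable_of_hasCompactSupport
      (((hc.pderiv i).pderiv i).mul_right)
  · exact ((hf' i).continuous.mul (hg' i).continuous).integrable_of_hasCompactSupport
      ((hc.pderiv i).mul_right)

/-- The regularized Newton kernel `(‖y‖² + e) ^ (-1/2)`; the Newton kernel itself is `e = 0`. -/
def newtonKernel (e : ℝ) (y : Euc 3) : ℝ := (‖y‖ ^ 2 + e) ^ (-(1 / 2) : ℝ)

theorem newtonKernel_nonneg {e : ℝ} (he : 0 ≤ e) (y : Euc 3) : 0 ≤ newtonKernel e y :=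
  Real.rpow_nonneg (by positivity) _

theorem newtonKernel_zero (y : Euc 3) : newtonKernel 0 y = ‖y‖⁻¹ := by
  rw [newtonKernel, add_zero, ← Real.rpow_natCast, ← Real.rpow_mul (norm_nonneg y)]
  norm_num
  exact Real.rpow_neg_one _

theorem newtonKernel_le {e : ℝ} (he : 0 ≤ e) {y : Euc 3} (hy : y ≠ 0) :
    newtonKernel e y ≤ newtonKernel 0 y := by
  have := norm_pos_iff.2 hy
  exact Real.rpow_le_rpow_of_nonpos (by positivity) (by linarith) (by norm_num)

theorem contDiffAt_norm_sq_add_rpow (p : ℝ) {e : ℝ} {y : Euc 3} (h : 0 < ‖y‖ ^ 2 + e) {k : ℕ∞ω} :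
    ContDiffAt ℝ k (fun y : Euc 3 => (‖y‖ ^ 2 + e) ^ p) y :=
  ((contDiff_norm_sq ℝ).contDiffAt.add contDiffAt_const).rpow_const_of_ne h.ne'

theorem contDiffAt_newtonKernel {e : ℝ} {y : Euc 3} (h : 0 < ‖y‖ ^ 2 + e) {k : ℕ∞ω} :
    ContDiffAt ℝ k (newtonKernel e) y :=
  contDiffAt_norm_sq_add_rpow _ h

theorem pderiv_norm_sq_add_rpow (p : ℝ) {e : ℝ} {y : Euc 3} (h : 0 < ‖y‖ ^ 2 + e) (i : Fin 3) :
    pderiv i (fun y : Euc 3 => (‖y‖ ^ 2 + e) ^ p) y = 2 * p * (y i * (‖y‖ ^ 2 + e) ^ (p - 1)) := by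
  have hd : DifferentiableAt ℝ (fun y : Euc 3 => ‖y‖ ^ 2) y :=
    (contDiff_norm_sq ℝ (n := 1)).differentiable (by simp) y
  have h2 : HasDerivAt (fun s : ℝ => (s + e) ^ p) (1 * p * (‖y‖ ^ 2 + e) ^ (p - 1)) (‖y‖ ^ 2) :=
    ((hasDerivAt_id _).add_const e).rpow_const (Or.inl h.ne')
  rw [pderiv_scomp (g := fun s => (s + e) ^ p) i h2.differentiableAt hd, h2.deriv, pderiv_norm_sq]
  ring

theorem eventually_norm_sq_add_pos {e : ℝ} {y : Euc 3} (h : 0 < ‖y‖ ^ 2 + e) :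
    ∀ᶠ z in 𝓝 y, 0 < ‖z‖ ^ 2 + e :=
  (by fun_prop : Continuous fun z : Euc 3 => ‖z‖ ^ 2 + e).continuousAt.eventually (lt_mem_nhds h)

theorem pderiv_coord (i : Fin 3) (y : Euc 3) : pderiv i (fun y : Euc 3 => y i) y = 1 := by
  have : HasFDerivAt (fun y : Euc 3 => y i) (EuclideanSpace.proj i : Euc 3 →L[ℝ] ℝ) y :=
    (EuclideanSpace.proj i : Euc 3 →L[ℝ] ℝ).hasFDerivAt
  simp [pderiv, this.fderiv]

theorem lap_newtonKernel {e : ℝ} {y : Euc 3} (h : 0 < ‖y‖ ^ 2 + e) :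
    lap (newtonKernel e) y = -3 * e * (‖y‖ ^ 2 + e) ^ (-(5 / 2) : ℝ) := by
  have key : ∀ i, pderiv i (pderiv i (newtonKernel e)) y
      = - (‖y‖ ^ 2 + e) ^ (-(3 / 2) : ℝ) + 3 * y i ^ 2 * (‖y‖ ^ 2 + e) ^ (-(5 / 2) : ℝ) := by
    intro i
    have h1 : pderiv i (newtonKernel e) =ᶠ[𝓝 y]
        fun z => (-1) * (z i * (‖z‖ ^ 2 + e) ^ (-(3 / 2) : ℝ)) := by
      filter_upwards [eventually_norm_sq_add_pos h] with z hz
      rw [show newtonKernel e = fun y : Euc 3 => (‖y‖ ^ 2 + e) ^ (-(1 / 2) : ℝ) from rfl,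
        pderiv_norm_sq_add_rpow _ hz]
      norm_num
    have hc : DifferentiableAt ℝ (fun z : Euc 3 => z i) y := by fun_prop
    have hr : DifferentiableAt ℝ (fun z : Euc 3 => (‖z‖ ^ 2 + e) ^ (-(3 / 2) : ℝ)) y :=
      (contDiffAt_norm_sq_add_rpow _ h (k := 1)).differentiableAt (by simp)
    rw [(h1.pderiv i).eq_of_nhds, pderiv_const_mul _ (hc.fun_mul hr), pderiv_mul hc hr,
      pderiv_coord, pderiv_norm_sq_add_rpow _ h]
    norm_num
    ring
  have h5 : (‖y‖ ^ 2 + e) ^ (-(3 / 2) : ℝ) = (‖y‖ ^ 2 + e) * (‖y‖ ^ 2 + e) ^ (-(5 / 2) : ℝ) := by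
    rw [← Real.rpow_one_add' h.le (by norm_num)]; norm_num
  have hn : ‖y‖ ^ 2 = y 0 ^ 2 + y 1 ^ 2 + y 2 ^ 2 := by
    simp [EuclideanSpace.norm_sq_eq, Fin.sum_univ_three]
  simp only [lap, key, Fin.sum_univ_three, h5]
  generalize (‖y‖ ^ 2 + e) ^ (-(5 / 2) : ℝ) = w
  rw [hn]
  ring

theorem measurable_newtonKernel (e : ℝ) : Measurable (newtonKernel e) := by
  unfold newtonKernel; fun_prop

theorem locallyIntegrable_newtonKernel : LocallyIntegrable (newtonKernel 0) := by
  refine locallyIntegrable_of_norm_le_rpow (C := 1) (α := 1) (by simp) (by simp)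
    (Eventually.of_forall fun y => ?_) (measurable_newtonKernel 0).aestronglyMeasurable
  rw [newtonKernel_zero, one_mul, Real.rpow_neg_one, norm_inv, norm_norm]

/-- The Newton potential of `g`, up to normalization. -/
def newtonPotential (g : Euc 3 → ℝ) (x : Euc 3) : ℝ := ∫ t, newtonKernel 0 t * g (x - t)

theorem contDiff_newtonPotential {g : Euc 3 → ℝ} (hg : ContDiff ℝ ∞ g)
    (hc : HasCompactSupport g) : ContDiff ℝ ∞ (newtonPotential g) :=
  contDiff_integral_mul_sub locallyIntegrable_newtonKernel hg hc

theorem pderiv_newtonPotential {g : Euc 3 → ℝ} (hg : ContDiff ℝ ∞ g)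
    (hc : HasCompactSupport g) (i : Fin 3) (x : Euc 3) :
    pderiv i (newtonPotential g) x = newtonPotential (pderiv i g) x :=
  pderiv_integral_mul_sub locallyIntegrable_newtonKernel hg hc i x

theorem newtonPotential_eq (g : Euc 3 → ℝ) (x : Euc 3) :
    newtonPotential g x = ∫ b, newtonKernel 0 (x - b) * g b := by
  rw [newtonPotential, ← integral_sub_left_eq_self _ volume x]
  simp

theorem integrable_newtonKernel_mul {g : Euc 3 → ℝ} (hg : Continuous g)
    (hc : HasCompactSupport g) (x : Euc 3) :
    Integrable fun t => newtonKernel 0 t * g (x - t) :=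
  hc.convolutionExists_right (ContinuousLinearMap.mul ℝ ℝ) locallyIntegrable_newtonKernel hg x

/-- The normalization constant of the Newton potential. -/
def newtonConst : ℝ := 3 * ∫ z : Euc 3, ((1 : ℝ) + ‖z‖ ^ 2) ^ (-5 / 2 : ℝ)

theorem integrable_one_add_norm_sq_rpow :
    Integrable fun z : Euc 3 => ((1 : ℝ) + ‖z‖ ^ 2) ^ (-5 / 2 : ℝ) :=
  integrable_rpow_neg_one_add_norm_sq (by simp; norm_num)

theorem newtonConst_pos : 0 < newtonConst := by
  refine mul_pos three_pos ((integral_pos_iff_support_of_nonneg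
    (fun z => by positivity) integrable_one_add_norm_sq_rpow).2 ?_)
  rw [show Function.support (fun z : Euc 3 => ((1 : ℝ) + ‖z‖ ^ 2) ^ (-5 / 2 : ℝ)) = univ from
    eq_univ_of_forall fun z => (by positivity : (0 : ℝ) < _).ne']
  simp

theorem tendsto_integral_newtonKernel {g : Euc 3 → ℝ} (hg : Continuous g)
    (hc : HasCompactSupport g) (x : Euc 3) :
    Tendsto (fun δ : ℝ => ∫ t, newtonKernel (δ ^ 2) t * g (x - t)) (𝓝[>] 0)
      (𝓝 (newtonPotential g x)) := by
  have hne : ∀ᵐ t : Euc 3, t ≠ 0 := Measure.ae_ne volume 0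
  refine tendsto_integral_filter_of_dominated_convergence
    (fun t => ‖newtonKernel 0 t * g (x - t)‖) ?_ ?_ (integrable_newtonKernel_mul hg hc x).norm ?_
  · exact Eventually.of_forall fun δ => ((measurable_newtonKernel _).mul
      (by fun_prop : Continuous fun t => g (x - t)).measurable).aestronglyMeasurable
  · refine Eventually.of_forall fun δ => ?_
    filter_upwards [hne] with t ht
    rw [norm_mul, norm_mul, Real.norm_of_nonneg (newtonKernel_nonneg (sq_nonneg δ) t),
      Real.norm_of_nonneg (newtonKernel_nonneg le_rfl t)]
    exact mul_le_mul_of_nonneg_right (newtonKernel_le (sq_nonneg δ) ht) (norm_nonneg _)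
  · filter_upwards [hne] with t ht
    refine Tendsto.mul_const _ (tendsto_nhdsWithin_of_tendsto_nhds ?_)
    have h1 : ContinuousAt (fun δ : ℝ => (‖t‖ ^ 2 + δ ^ 2) ^ (-(1 / 2) : ℝ)) 0 :=
      ContinuousAt.rpow_const (by fun_prop) (Or.inl (by simpa using ht))
    simpa [ContinuousAt, newtonKernel] using h1

theorem integral_newtonKernel_mul_lap {g : Euc 3 → ℝ} (hg : ContDiff ℝ ∞ g)
    (hc : HasCompactSupport g) (x : Euc 3) {δ : ℝ} (hδ : 0 < δ) :
    ∫ t, newtonKernel (δ ^ 2) t * lap g (x - t)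
      = -3 * ∫ z : Euc 3, ((1 : ℝ) + ‖z‖ ^ 2) ^ (-5 / 2 : ℝ) * g (x - δ • z) := by
  have hpos : ∀ t : Euc 3, 0 < ‖t‖ ^ 2 + δ ^ 2 := fun t => by positivity
  have hk : ContDiff ℝ 2 (newtonKernel (δ ^ 2)) :=
    contDiff_iff_contDiffAt.2 fun t => contDiffAt_newtonKernel (hpos t)
  have hg2 : ContDiff ℝ 2 g := hg.of_le two_le_infty
  have hlap : ∀ t, lap g (x - t) = lap (fun t => g (x + (-1 : ℝ) • t)) t := fun t => by
    rw [lap_comp_add_smul hg2]; simp [sub_eq_add_neg]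
  have hc' : HasCompactSupport fun t => g (x + (-1 : ℝ) • t) := by
    have := hc.comp_homeomorph (Homeomorph.subLeft x)
    simpa [Function.comp_def, sub_eq_add_neg] using this
  calc ∫ t, newtonKernel (δ ^ 2) t * lap g (x - t)
      = ∫ t, lap (fun t => g (x + (-1 : ℝ) • t)) t * newtonKernel (δ ^ 2) t := by
        simp only [hlap, mul_comm]
    _ = ∫ t, g (x + (-1 : ℝ) • t) * lap (newtonKernel (δ ^ 2)) t :=
        (integral_mul_lap_comm (hg2.comp (by fun_prop)) hk hc').symm
    _ = ∫ t, g (x - t) * (-3 * δ ^ 2 * (‖t‖ ^ 2 + δ ^ 2) ^ (-(5 / 2) : ℝ)) := by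
        simp only [lap_newtonKernel (hpos _), neg_smul, one_smul, sub_eq_add_neg]
    _ = δ ^ 3 * ∫ z : Euc 3, g (x - δ • z) *
          (-3 * δ ^ 2 * (‖δ • z‖ ^ 2 + δ ^ 2) ^ (-(5 / 2) : ℝ)) := by
        rw [Measure.integral_comp_smul volume
          (fun t => g (x - t) * (-3 * δ ^ 2 * (‖t‖ ^ 2 + δ ^ 2) ^ (-(5 / 2) : ℝ))) δ,
          finrank_euclideanSpace_fin, abs_of_pos (by positivity), smul_eq_mul,
          mul_inv_cancel_left₀ (by positivity)]
    _ = _ := by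
        rw [← integral_const_mul, ← integral_const_mul]
        refine integral_congr_ae (Eventually.of_forall fun z => ?_)
        have h1 : ‖δ • z‖ ^ 2 + δ ^ 2 = δ ^ 2 * (1 + ‖z‖ ^ 2) := by
          rw [norm_smul, Real.norm_of_nonneg hδ.le]; ring
        have h2 : (δ ^ 2) ^ (-(5 / 2) : ℝ) = (δ ^ 5)⁻¹ := by
          rw [← Real.rpow_natCast, ← Real.rpow_mul hδ.le, ← Real.rpow_natCast, ← Real.rpow_neg hδ.le]
          norm_num
        simp only [h1]
        rw [Real.mul_rpow (by positivity) (by positivity), h2,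
          show (-(5 / 2) : ℝ) = -5 / 2 by norm_num]
        field_simp

theorem newtonPotential_lap {g : Euc 3 → ℝ} (hg : ContDiff ℝ ∞ g)
    (hc : HasCompactSupport g) (x : Euc 3) :
    newtonPotential (lap g) x = - newtonConst * g x := by
  have hl : Continuous (lap g) :=
    (contDiff_iff_contDiffAt.2 fun y => (hg.contDiffAt (x := y)).lap).continuous
  have hgc := hg.continuous
  obtain ⟨C, hC⟩ := hc.exists_bound_of_continuous hgc
  refine tendsto_nhds_unique (tendsto_integral_newtonKernel hl hc.lap x) ?_
  have h1 : Tendsto (fun δ : ℝ => ∫ z : Euc 3, ((1 : ℝ) + ‖z‖ ^ 2) ^ (-5 / 2 : ℝ) *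
      g (x - δ • z)) (𝓝[>] 0) (𝓝 (∫ z : Euc 3, ((1 : ℝ) + ‖z‖ ^ 2) ^ (-5 / 2 : ℝ) * g x)) := by
    refine tendsto_integral_filter_of_dominated_convergence
      (fun z => ((1 : ℝ) + ‖z‖ ^ 2) ^ (-5 / 2 : ℝ) * C) ?_ ?_
      (integrable_one_add_norm_sq_rpow.mul_const C) ?_
    · exact Eventually.of_forall fun δ => (by fun_prop : Measurable fun z : Euc 3 =>
        ((1 : ℝ) + ‖z‖ ^ 2) ^ (-5 / 2 : ℝ)).aestronglyMeasurable.mul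
        (by fun_prop : Continuous fun z => g (x - δ • z)).aestronglyMeasurable
    · refine Eventually.of_forall fun δ => Eventually.of_forall fun z => ?_
      rw [norm_mul, Real.norm_of_nonneg (by positivity)]
      exact mul_le_mul_of_nonneg_left (hC _) (by positivity)
    · refine Eventually.of_forall fun z => Tendsto.const_mul _
        (tendsto_nhdsWithin_of_tendsto_nhds ?_)
      have : Continuous fun δ : ℝ => g (x - δ • z) := by fun_prop
      simpa using this.tendsto 0
  have h2 := h1.const_mul (-3)
  rw [integral_mul_const] at h2
  rw [show - newtonConst * g x = -3 * ((∫ z : Euc 3, ((1 : ℝ) + ‖z‖ ^ 2) ^ (-5 / 2 : ℝ)) * g x) by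
    rw [newtonConst]; ring]
  refine h2.congr' ?_
  filter_upwards [self_mem_nhdsWithin] with δ hδ
  exact (integral_newtonKernel_mul_lap hg hc x hδ).symm

theorem lap_newtonPotential {g : Euc 3 → ℝ} (hg : ContDiff ℝ ∞ g)
    (hc : HasCompactSupport g) (x : Euc 3) :
    lap (newtonPotential g) x = - newtonConst * g x :=
  (lap_integral_mul_sub locallyIntegrable_newtonKernel hg hc x).trans (newtonPotential_lap hg hc x)

theorem tendsto_newtonPotential {g : Euc 3 → ℝ} (hg : Continuous g) (hc : HasCompactSupport g) :
    Tendsto (newtonPotential g) (cocompact (Euc 3)) (𝓝 0) := by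
  obtain ⟨R, hR⟩ := hc.isCompact.isBounded.subset_closedBall (0 : Euc 3)
  have hInt := (hg.integrable_of_hasCompactSupport hc (μ := volume)).norm
  have h1 : Tendsto (fun x : Euc 3 => (‖x‖ - R)⁻¹ * ∫ b, ‖g b‖) (cocompact (Euc 3))
      (𝓝 (0 * ∫ b, ‖g b‖)) := by
    refine Tendsto.mul_const _ (tendsto_inv_atTop_zero.comp ?_)
    exact tendsto_atTop_add_const_right _ _ (tendsto_norm_cocompact_atTop (E := Euc 3))
  rw [zero_mul] at h1
  refine squeeze_zero_norm' ?_ h1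
  filter_upwards [(tendsto_norm_cocompact_atTop (E := Euc 3)).eventually (eventually_gt_atTop R)]
    with x hx
  rw [newtonPotential_eq, ← integral_const_mul]
  refine norm_integral_le_of_norm_le (hInt.const_mul _) (Eventually.of_forall fun b => ?_)
  by_cases hb : b ∈ tsupport g
  · have hb' : ‖b‖ ≤ R := by simpa using hR hb
    have := norm_sub_norm_le x b
    rw [norm_mul, newtonKernel_zero, norm_inv, norm_norm]
    refine mul_le_mul_of_nonneg_right ?_ (norm_nonneg _)
    exact inv_anti₀ (by linarith) (by linarith)
  · simp [image_eq_zero_of_notMem_tsupport hb]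

/-- The `n`-th derivative of `f` at `a` along `-b`, as a polynomial in the components of `b`. -/
def dirDeriv : ℕ → (Euc 3 → ℝ) → Euc 3 → Euc 3 → ℝ
  | 0, f, a, _ => f a
  | n + 1, f, a, b => ∑ i, (-b i) * dirDeriv n (pderiv i f) a b

theorem continuous_dirDeriv (n : ℕ) (f : Euc 3 → ℝ) (a : Euc 3) : Continuous (dirDeriv n f a) := by
  induction n generalizing f with
  | zero => exact continuous_const
  | succ n ih =>
    have : ∀ i : Fin 3, Continuous fun b : Euc 3 => -b i := fun i => by fun_prop
    exact continuous_finsetSum _ fun i _ => (this i).mul (ih _)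

theorem hasDerivAt_dirDeriv (n : ℕ) {f : Euc 3 → ℝ} {a b : Euc 3} {t : ℝ}
    (hf : ContDiffAt ℝ ∞ f (a - t • b)) :
    HasDerivAt (fun t : ℝ => dirDeriv n f (a - t • b) b) (dirDeriv (n + 1) f (a - t • b) b) t := by
  induction n generalizing f with
  | zero =>
    have h1 : HasDerivAt (fun t : ℝ => a - t • b) (-((1 : ℝ) • b)) t :=
      ((hasDerivAt_id t).smul_const b).const_sub a
    have h2 := (hf.differentiableAt (by simp)).hasFDerivAt.comp_hasDerivAt t h1
    refine h2.congr_deriv ?_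
    rw [fderiv_eq_sum_pderiv]
    simp [dirDeriv]
  | succ n ih =>
    exact HasDerivAt.fun_sum fun i _ => (ih (hf.pderiv i (m := ∞) (by simp))).const_mul _

/-- The integral of `dirDeriv n f a b * h b` over `b`. -/
def dirMoment : ℕ → (Euc 3 → ℝ) → (Euc 3 → ℝ) → Euc 3 → ℝ
  | 0, f, h, a => (∫ b, h b) * f a
  | n + 1, f, h, a => ∑ i, dirMoment n (pderiv i f) (fun b => -b i * h b) a

theorem dirMoment_eq (n : ℕ) (f : Euc 3 → ℝ) {h : Euc 3 → ℝ} (hh : Continuous h)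
    (hc : HasCompactSupport h) (a : Euc 3) :
    dirMoment n f h a = ∫ b, dirDeriv n f a b * h b := by
  induction n generalizing f h with
  | zero => simp [dirMoment, dirDeriv, integral_const_mul, mul_comm]
  | succ n ih =>
    have hi : ∀ i : Fin 3, Continuous fun b : Euc 3 => -b i * h b := fun i => by fun_prop
    have hci : ∀ i : Fin 3, HasCompactSupport fun b : Euc 3 => -b i * h b := fun i => hc.mul_left
    simp only [dirMoment, dirDeriv, Finset.sum_mul]
    rw [integral_finsetSum _ fun i _ => ?_]
    · refine Finset.sum_congr rfl fun i _ => ?_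
      rw [ih _ (hi i) (hci i)]
      exact integral_congr_ae (Eventually.of_forall fun b => by simp only; ring)
    · have := ((continuous_dirDeriv n (pderiv i f) a).mul (hi i)).integrable_of_hasCompactSupport
        (μ := volume) (hci i).mul_left
      refine this.congr (Eventually.of_forall fun b => by simp only [Pi.mul_apply]; ring)

theorem dirMoment_harmonic (n : ℕ) {f : Euc 3 → ℝ} (h : Euc 3 → ℝ) {a : Euc 3}
    (hf : ContDiffAt ℝ ∞ f a) (hl : ∀ᶠ z in 𝓝 a, lap f z = 0) :
    ContDiffAt ℝ ∞ (dirMoment n f h) a ∧ lap (dirMoment n f h) a = 0 := by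
  induction n generalizing f h with
  | zero =>
    refine ⟨contDiffAt_const.mul hf, ?_⟩
    exact (lap_const_mul _ (hf.of_le two_le_infty)).trans (by rw [hl.self_of_nhds, mul_zero])
  | succ n ih =>
    have hi := fun i : Fin 3 => ih (fun b => -b i * h b) (hf.pderiv i (m := ∞) (by simp)) (by
      have h3 : ContDiffAt ℝ 3 f a := hf.of_le (WithTop.coe_le_coe.2 (le_top : (3 : ℕ∞) ≤ ⊤))
      filter_upwards [h3.eventually (by simp), hl.eventually_nhds] with z hz hlz
      rw [lap_pderiv hz]
      exact pderiv_eq_zero_of_eventuallyEq_zero hlz i)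
    refine ⟨ContDiffAt.sum fun i _ => (hi i).1, ?_⟩
    exact (lap_sum fun i _ => (hi i).1.of_le two_le_infty).trans
      (Finset.sum_eq_zero fun i _ => (hi i).2)

theorem norm_sq_add_zero_pos {y : Euc 3} (hy : y ≠ 0) : 0 < ‖y‖ ^ 2 + 0 := by
  have := norm_pos_iff.2 hy; positivity

theorem contDiffAt_newtonKernel_zero {y : Euc 3} (hy : y ≠ 0) :
    ContDiffAt ℝ ∞ (newtonKernel 0) y :=
  contDiffAt_newtonKernel (norm_sq_add_zero_pos hy)

theorem dirDeriv_newtonKernel_recurrence (n : ℕ) {y : Euc 3} (b : Euc 3) (hy : y ≠ 0) :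
    ‖y‖ ^ 2 * dirDeriv (n + 1) (newtonKernel 0) y b
      - (2 * n + 1) * inner ℝ y b * dirDeriv n (newtonKernel 0) y b
      + n ^ 2 * ‖b‖ ^ 2 * dirDeriv (n - 1) (newtonKernel 0) y b = 0 := by
  induction n generalizing y with
  | zero =>
    have hp := norm_sq_add_zero_pos hy
    have h1 : ∀ i, pderiv i (newtonKernel 0) y = - (y i * (‖y‖ ^ 2 + 0) ^ (-(3 / 2) : ℝ)) := by
      intro i
      refine (pderiv_norm_sq_add_rpow _ hp i).trans ?_
      norm_num
    have h2 : newtonKernel 0 y = (‖y‖ ^ 2 + 0) * (‖y‖ ^ 2 + 0) ^ (-(3 / 2) : ℝ) := by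
      rw [← Real.rpow_one_add' hp.le (by norm_num), newtonKernel]; norm_num
    have h3 : inner ℝ y b = y 0 * b 0 + y 1 * b 1 + y 2 * b 2 := by
      simp [PiLp.inner_apply, Fin.sum_univ_three, mul_comm]
    simp only [dirDeriv, h1, h2, h3, Fin.sum_univ_three]
    push_cast
    ring
  | succ n ih =>
    have hd : ∀ m, HasDerivAt (fun t : ℝ => dirDeriv m (newtonKernel 0) (y - t • b) b)
        (dirDeriv (m + 1) (newtonKernel 0) y b) 0 := fun m => by
      have := hasDerivAt_dirDeriv m (f := newtonKernel 0) (a := y) (b := b) (t := 0)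
        (by simpa using contDiffAt_newtonKernel_zero hy)
      simpa using this
    have hpath : HasDerivAt (fun t : ℝ => y - t • b) (-b) 0 := by
      simpa using ((hasDerivAt_id (0 : ℝ)).smul_const b).const_sub y
    have hnorm : HasDerivAt (fun t : ℝ => ‖y - t • b‖ ^ 2) (- 2 * inner ℝ y b) 0 := by
      refine hpath.norm_sq.congr_deriv ?_
      simp
    have hinner : HasDerivAt (fun t : ℝ => inner ℝ (y - t • b) b) (- ‖b‖ ^ 2) 0 := by
      refine (hpath.inner ℝ (hasDerivAt_const 0 b)).congr_deriv ?_
      simp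
    have hlast : HasDerivAt (fun t : ℝ => (n : ℝ) ^ 2 * ‖b‖ ^ 2 *
        dirDeriv (n - 1) (newtonKernel 0) (y - t • b) b)
        ((n : ℝ) ^ 2 * ‖b‖ ^ 2 * dirDeriv n (newtonKernel 0) y b) 0 := by
      cases n with
      | zero => simpa using hasDerivAt_const (0 : ℝ) (0 : ℝ)
      | succ m => exact (hd m).const_mul _
    have htot := ((hnorm.fun_mul (hd (n + 1))).fun_sub
      ((hinner.const_mul (2 * (n : ℝ) + 1)).fun_mul (hd n))).fun_add hlast
    have hne : ∀ᶠ t : ℝ in 𝓝 0, y - t • b ≠ 0 :=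
      hpath.continuousAt.eventually_ne (by simpa using hy)
    have hzero := htot.congr_of_eventuallyEq (f₁ := fun _ => 0)
      (by filter_upwards [hne] with t ht using (ih ht).symm)
    have := hzero.unique (hasDerivAt_const 0 0)
    simp only [zero_smul, sub_zero] at this
    simp only [Nat.add_sub_cancel]
    push_cast
    linarith

theorem abs_dirDeriv_newtonKernel_le (n : ℕ) {y b : Euc 3} (hy : y ≠ 0) (hb : 7 * ‖b‖ ≤ ‖y‖) :
    |dirDeriv n (newtonKernel 0) y b| ≤ n.factorial * (1 / 2) ^ n * ‖y‖⁻¹ := by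
  have hy0 := norm_pos_iff.2 hy
  have step : ∀ n : ℕ, |dirDeriv (n + 1) (newtonKernel 0) y b| ≤
      (2 * n + 1) / 7 * |dirDeriv n (newtonKernel 0) y b|
        + n ^ 2 / 49 * |dirDeriv (n - 1) (newtonKernel 0) y b| := by
    intro n
    have hrec := dirDeriv_newtonKernel_recurrence n b hy
    set p := dirDeriv (n + 1) (newtonKernel 0) y b
    set q := dirDeriv n (newtonKernel 0) y b
    set s := dirDeriv (n - 1) (newtonKernel 0) y b
    have hin : |inner ℝ y b| ≤ ‖y‖ ^ 2 / 7 :=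
      (abs_real_inner_le_norm y b).trans (by nlinarith)
    have hb2 : ‖b‖ ^ 2 ≤ ‖y‖ ^ 2 / 49 := by nlinarith [norm_nonneg b]
    have h1 : ‖y‖ ^ 2 * |p| ≤ (2 * n + 1) * |inner ℝ y b| * |q| + n ^ 2 * ‖b‖ ^ 2 * |s| := by
      have : ‖y‖ ^ 2 * p = (2 * n + 1) * inner ℝ y b * q - n ^ 2 * ‖b‖ ^ 2 * s := by linarith
      calc ‖y‖ ^ 2 * |p| = |‖y‖ ^ 2 * p| := by rw [abs_mul, abs_of_nonneg (sq_nonneg ‖y‖)]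
        _ ≤ |(2 * n + 1) * inner ℝ y b * q| + |n ^ 2 * ‖b‖ ^ 2 * s| := by
          rw [this]; exact abs_sub _ _
        _ = _ := by
          rw [abs_mul, abs_mul, abs_mul (_ * _), abs_of_nonneg (by positivity : (0 : ℝ) ≤ 2 * n + 1),
            abs_of_nonneg (by positivity : (0 : ℝ) ≤ n ^ 2 * ‖b‖ ^ 2)]
    have h2 : (2 * n + 1) * |inner ℝ y b| * |q| ≤ (2 * n + 1) * (‖y‖ ^ 2 / 7) * |q| := by gcongr
    have h3 : (n : ℝ) ^ 2 * ‖b‖ ^ 2 * |s| ≤ n ^ 2 * (‖y‖ ^ 2 / 49) * |s| := by gcongr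
    refine le_of_mul_le_mul_left ?_ (by positivity : 0 < ‖y‖ ^ 2)
    linarith
  have h0 : |dirDeriv 0 (newtonKernel 0) y b| ≤ Nat.factorial 0 * (1 / 2) ^ 0 * ‖y‖⁻¹ := by
    simp [dirDeriv, newtonKernel_zero]
  have hi : 0 ≤ ‖y‖⁻¹ := by positivity
  induction n using Nat.twoStepInduction with
  | zero => exact h0
  | one =>
    refine (step 0).trans ?_
    norm_num at h0 ⊢
    linarith
  | more n h1 h2 =>
    refine (step (n + 1)).trans ?_
    simp only [Nat.add_sub_cancel]
    refine (add_le_add (mul_le_mul_of_nonneg_left h2 (by positivity))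
      (mul_le_mul_of_nonneg_left h1 (by positivity))).trans ?_
    rw [Nat.factorial_succ (n + 1), Nat.factorial_succ n, pow_succ _ (n + 1), pow_succ _ n]
    push_cast
    have hF : 0 ≤ (n.factorial : ℝ) * (1 / 2) ^ n * ‖y‖⁻¹ := by positivity
    generalize (n.factorial : ℝ) = F at *
    generalize ((1 / 2 : ℝ) ^ n) = P at *
    generalize ‖y‖⁻¹ = Y at *
    have hn : (0 : ℝ) ≤ n := n.cast_nonneg
    have : 0 ≤ (F * P * Y) * ((n + 1) * (((n : ℝ) + 2) / 4 - (2 * (n + 1) + 1) / 14 - (n + 1) / 49)) :=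
      mul_nonneg hF (mul_nonneg (by linarith) (by linarith))
    linarith

theorem abs_sub_taylor_le {φ : ℕ → ℝ → ℝ} (M : ℕ) {B : ℝ}
    (hφ : ∀ n, ∀ t ∈ Icc (0 : ℝ) 1, HasDerivAt (φ n) (φ (n + 1) t) t)
    (hB : ∀ t ∈ Icc (0 : ℝ) 1, |φ (M + 1) t| ≤ B) :
    |φ 0 1 - ∑ n ∈ Finset.range (M + 1), (n.factorial : ℝ)⁻¹ * φ n 0| ≤ B / M.factorial := by
  have hg : ∀ M : ℕ, ∀ t ∈ Icc (0 : ℝ) 1, HasDerivAt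
      (fun t => ∑ n ∈ Finset.range (M + 1), (n.factorial : ℝ)⁻¹ * (1 - t) ^ n * φ n t)
      ((M.factorial : ℝ)⁻¹ * (1 - t) ^ M * φ (M + 1) t) t := by
    intro M t ht
    induction M with
    | zero => simpa using hφ 0 t ht
    | succ M ih =>
      simp only [Finset.sum_range_succ _ (M + 1)]
      have h1 : HasDerivAt (fun t : ℝ => (1 - t) ^ (M + 1)) (((M + 1 : ℕ) : ℝ) * (1 - t) ^ M * (-1)) t := by
        simpa using ((hasDerivAt_id t).const_sub 1).fun_pow (M + 1)
      refine (ih.fun_add ((h1.const_mul (((M + 1).factorial : ℝ)⁻¹)).fun_mul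
        (hφ (M + 1) t ht))).congr_deriv ?_
      rw [Nat.factorial_succ]
      push_cast
      field_simp
      ring
  have hm := norm_image_sub_le_of_norm_deriv_le_segment_01'
    (f := fun t => ∑ n ∈ Finset.range (M + 1), (n.factorial : ℝ)⁻¹ * (1 - t) ^ n * φ n t)
    (C := B / M.factorial) (fun t ht => (hg M t ht).hasDerivWithinAt) (fun t ht => by
      have ht' : t ∈ Icc (0 : ℝ) 1 := ⟨ht.1, ht.2.le⟩
      have h1 : |(1 - t) ^ M| ≤ 1 := by
        rw [abs_pow]
        exact pow_le_one₀ (abs_nonneg _) (abs_le.2 ⟨by linarith [ht.2], by linarith [ht.1]⟩)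
      rw [Real.norm_eq_abs, abs_mul, abs_mul, abs_of_pos (by positivity), div_eq_inv_mul, mul_assoc]
      refine mul_le_mul_of_nonneg_left ?_ (by positivity)
      exact (mul_le_of_le_one_left (abs_nonneg _) h1).trans (hB t ht'))
  have e1 : ∑ n ∈ Finset.range (M + 1), (n.factorial : ℝ)⁻¹ * (1 - 1) ^ n * φ n 1 = φ 0 1 := by
    rw [Finset.sum_range_succ']
    simp
  simp only [e1, sub_zero, one_pow, mul_one] at hm
  exact hm

theorem abs_newtonKernel_sub_taylor_le (M : ℕ) {a b : Euc 3} (ha : a ≠ 0) (hb : 8 * ‖b‖ ≤ ‖a‖) :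
    |newtonKernel 0 (a - b) - ∑ n ∈ Finset.range (M + 1),
      (n.factorial : ℝ)⁻¹ * dirDeriv n (newtonKernel 0) a b| ≤ (M + 1) * (1 / 2) ^ M * ‖a‖⁻¹ := by
  have ha0 := norm_pos_iff.2 ha
  have hfar : ∀ t ∈ Icc (0 : ℝ) 1, 7 / 8 * ‖a‖ ≤ ‖a - t • b‖ := fun t ht => by
    have h1 := norm_sub_norm_le a (t • b)
    rw [norm_smul, Real.norm_of_nonneg ht.1] at h1
    nlinarith [ht.2, norm_nonneg b]
  have hne : ∀ t ∈ Icc (0 : ℝ) 1, a - t • b ≠ 0 := fun t ht =>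
    norm_pos_iff.1 (by linarith [hfar t ht])
  have h := abs_sub_taylor_le (φ := fun n t => dirDeriv n (newtonKernel 0) (a - t • b) b) M
    (B := (M + 1).factorial * (1 / 2) ^ (M + 1) * (2 * ‖a‖⁻¹))
    (fun n t ht => hasDerivAt_dirDeriv n (contDiffAt_newtonKernel_zero (hne t ht)))
    (fun t ht => (abs_dirDeriv_newtonKernel_le (M + 1) (hne t ht) (by linarith [hfar t ht])).trans
      (mul_le_mul_of_nonneg_left ?_ (by positivity)))
  · simp only [one_smul, zero_smul, sub_zero] at h
    refine h.trans (le_of_eq ?_)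
    rw [Nat.factorial_succ, pow_succ]
    push_cast
    field_simp
  · rw [← inv_inv (2 : ℝ), ← mul_inv]
    exact inv_anti₀ (by positivity) (by linarith [hfar t ht])

/-- A compactly supported source can be removed by a potential singular at a single point, with an
arbitrarily small potential away from that point. -/
theorem exists_lap_eq_compl_singleton {h : Euc 3 → ℝ} (hh : ContDiff ℝ ∞ h) {p : Euc 3} {r : ℝ}
    (hs : tsupport h ⊆ Metric.closedBall p r) {ε : ℝ} (hε : 0 < ε) :
    ∃ ψ : Euc 3 → ℝ, ContDiffOn ℝ ∞ ψ {p}ᶜ ∧ (∀ x, x ≠ p → lap ψ x = h x) ∧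
      ∀ x, x ≠ p → 8 * r ≤ ‖x - p‖ → |ψ x| ≤ ε * ‖x - p‖⁻¹ := by
  set g : Euc 3 → ℝ := fun y => h (y + p) with hg
  have hgs : ContDiff ℝ ∞ g := hh.comp (by fun_prop)
  have hcl : ∀ b, r < ‖b‖ → g b = 0 := fun b hb => by
    refine image_eq_zero_of_notMem_tsupport (f := h) fun hb' => ?_
    have := hs hb'
    simp at this
    linarith
  have hgc : HasCompactSupport g := HasCompactSupport.intro (isCompact_closedBall 0 r)
    fun b hb => hcl b (by simpa using hb)
  have hgi := (hgs.continuous.integrable_of_hasCompactSupport hgc (μ := volume))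
  have hC := newtonConst_pos
  obtain ⟨M, hM⟩ : ∃ M : ℕ, newtonConst⁻¹ * (((M : ℝ) + 1) * (1 / 2) ^ M * ∫ b, ‖g b‖) ≤ ε := by
    have h1 : Tendsto (fun M : ℕ => ((M : ℝ) + 1) * (1 / 2) ^ M) atTop (𝓝 (0 + 0)) := by
      simp only [add_mul, one_mul]
      exact (tendsto_self_mul_const_pow_of_lt_one (by norm_num) (by norm_num)).add
        (tendsto_pow_atTop_nhds_zero_of_lt_one (by norm_num) (by norm_num))
    have h2 := (h1.mul_const (∫ b, ‖g b‖)).const_mul newtonConst⁻¹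
    simp only [add_zero, zero_mul, mul_zero] at h2
    exact (h2.eventually (ge_mem_nhds hε)).exists
  set H : Euc 3 → ℝ := fun a =>
    ∑ n ∈ Finset.range (M + 1), (n.factorial : ℝ)⁻¹ * dirMoment n (newtonKernel 0) g a with hH
  have hmom : ∀ n, ∀ a : Euc 3, a ≠ 0 → ContDiffAt ℝ ∞ (dirMoment n (newtonKernel 0) g) a ∧
      lap (dirMoment n (newtonKernel 0) g) a = 0 := fun n a ha => by
    refine dirMoment_harmonic n g (contDiffAt_newtonKernel_zero ha) ?_
    filter_upwards [isOpen_ne.mem_nhds ha] with z hz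
    rw [lap_newtonKernel (norm_sq_add_zero_pos hz)]
    simp
  have hHs : ∀ a : Euc 3, a ≠ 0 → ContDiffAt ℝ ∞ H a := fun a ha =>
    ContDiffAt.sum fun n _ => contDiffAt_const.mul (hmom n a ha).1
  have hHl : ∀ a : Euc 3, a ≠ 0 → lap H a = 0 := fun a ha => by
    rw [hH, lap_sum fun n _ => contDiffAt_const.mul ((hmom n a ha).1.of_le two_le_infty)]
    refine Finset.sum_eq_zero fun n _ => ?_
    rw [lap_const_mul _ ((hmom n a ha).1.of_le two_le_infty), (hmom n a ha).2, mul_zero]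
  have hNs := contDiff_newtonPotential hgs hgc
  set ψ : Euc 3 → ℝ := fun a => (-newtonConst⁻¹) * (newtonPotential g a + (-1) * H a) with hψ
  have hψs : ∀ a : Euc 3, a ≠ 0 → ContDiffAt ℝ ∞ ψ a := fun a ha =>
    contDiffAt_const.mul (hNs.contDiffAt.add (contDiffAt_const.mul (hHs a ha)))
  have hψl : ∀ a : Euc 3, a ≠ 0 → lap ψ a = g a := fun a ha => by
    have e1 : ContDiffAt ℝ 2 (newtonPotential g) a := hNs.contDiffAt.of_le two_le_infty
    have e2 : ContDiffAt ℝ 2 H a := (hHs a ha).of_le two_le_infty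
    rw [hψ, lap_const_mul _ (e1.add (contDiffAt_const.mul e2)),
      lap_add e1 (contDiffAt_const.mul e2), lap_const_mul _ e2, hHl a ha,
      lap_newtonPotential hgs hgc]
    field_simp
    ring
  have hψb : ∀ a : Euc 3, a ≠ 0 → 8 * r ≤ ‖a‖ → |ψ a| ≤ ε * ‖a‖⁻¹ := fun a ha har => by
    have hInt : ∀ n, Integrable fun b => dirDeriv n (newtonKernel 0) a b * g b := fun n =>
      ((continuous_dirDeriv n _ a).mul hgs.continuous).integrable_of_hasCompactSupport hgc.mul_left
    have hInt0 : Integrable fun b => newtonKernel 0 (a - b) * g b := by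
      have := (integrable_newtonKernel_mul hgs.continuous hgc a).comp_sub_left a
      simpa using this
    have hInt1 : ∀ n ∈ Finset.range (M + 1), Integrable fun b =>
        (n.factorial : ℝ)⁻¹ * (dirDeriv n (newtonKernel 0) a b * g b) :=
      fun n _ => (hInt n).const_mul _
    have hsum : newtonPotential g a + (-1) * H a = ∫ b, (newtonKernel 0 (a - b) -
        ∑ n ∈ Finset.range (M + 1), (n.factorial : ℝ)⁻¹ * dirDeriv n (newtonKernel 0) a b)
          * g b := by
      rw [newtonPotential_eq, hH]
      simp only [dirMoment_eq _ _ hgs.continuous hgc, ← integral_const_mul]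
      rw [← integral_finsetSum _ hInt1, neg_one_mul, ← sub_eq_add_neg,
        ← integral_sub hInt0 (integrable_finsetSum _ hInt1)]
      simp only [sub_mul, Finset.sum_mul, mul_assoc]
    have hbound : ‖newtonPotential g a + (-1) * H a‖
        ≤ ∫ b, (M + 1) * (1 / 2) ^ M * ‖a‖⁻¹ * ‖g b‖ := by
      rw [hsum]
      refine norm_integral_le_of_norm_le (hgi.norm.const_mul _) (Eventually.of_forall fun b => ?_)
      rcases le_or_gt ‖b‖ r with hb | hb
      · rw [norm_mul]
        exact mul_le_mul_of_nonneg_right (abs_newtonKernel_sub_taylor_le M ha (by linarith))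
          (norm_nonneg _)
      · simp [hcl b hb]
    rw [integral_const_mul] at hbound
    rw [hψ]
    simp only
    rw [abs_mul, abs_neg, abs_of_pos (inv_pos.2 hC)]
    calc newtonConst⁻¹ * |newtonPotential g a + -1 * H a|
        ≤ newtonConst⁻¹ * ((M + 1) * (1 / 2) ^ M * ‖a‖⁻¹ * ∫ b, ‖g b‖) :=
          mul_le_mul_of_nonneg_left hbound (inv_pos.2 hC).le
      _ = newtonConst⁻¹ * (((M : ℝ) + 1) * (1 / 2) ^ M * ∫ b, ‖g b‖) * ‖a‖⁻¹ := by ring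
      _ ≤ _ := mul_le_mul_of_nonneg_right hM (by positivity)
  refine ⟨fun x => ψ (x - p), fun x hx => ?_, fun x hx => ?_, fun x hx hr => ?_⟩
  · have h1 : ContDiffAt ℝ ∞ (fun x : Euc 3 => x - p) x := by fun_prop
    exact (ContDiffAt.comp (g := ψ) x (hψs (x - p) (sub_ne_zero.2 hx)) h1).contDiffWithinAt
  · rw [lap_comp_sub, hψl _ (sub_ne_zero.2 hx)]
    simp [hg]
  · exact hψb _ (sub_ne_zero.2 hx) hr

open scoped Manifold in
theorem exists_contDiff_partition {n : ℕ} {ι : Type} [Fintype ι] {S : Set (Euc n)}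
    (hS : IsClosed S) (U : ι → Set (Euc n)) (hU : ∀ i, IsOpen (U i)) (hSU : S ⊆ ⋃ i, U i) :
    ∃ f : ι → Euc n → ℝ, (∀ i, ContDiff ℝ ∞ (f i)) ∧ (∀ i, tsupport (f i) ⊆ U i) ∧
      ∀ x ∈ S, ∑ i, f i x = 1 := by
  obtain ⟨f, hf⟩ := SmoothPartitionOfUnity.exists_isSubordinate 𝓘(ℝ, Euc n) hS U hU hSU
  refine ⟨fun i => f i, fun i => (f i).contMDiff.contDiff, hf, fun x hx => ?_⟩
  rw [← f.sum_eq_one hx, finsum_eq_sum_of_fintype]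

/-- A source supported near `K` can be removed by a potential on the complement of `K` which is
small away from `K` and vanishes at infinity. -/
theorem exists_lap_eq_compl {K : Set (Euc 3)} {h : Euc 3 → ℝ} (hh : ContDiff ℝ ∞ h)
    (hc : HasCompactSupport h) {r : ℝ} (hr : 0 < r) (hs : tsupport h ⊆ Metric.thickening r K)
    {ε : ℝ} (hε : 0 < ε) :
    ∃ ψ : Euc 3 → ℝ, ContDiffOn ℝ ∞ ψ Kᶜ ∧ (∀ x ∉ K, lap ψ x = h x) ∧
      (∀ x ∉ K, (∀ p ∈ K, 8 * r ≤ ‖x - p‖) → |ψ x| ≤ ε) ∧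
      Tendsto ψ (cocompact (Euc 3)) (𝓝 0) := by
  obtain ⟨t, ht⟩ := hc.isCompact.elim_finite_subcover (fun p : K => Metric.ball (p : Euc 3) r)
    (fun _ => Metric.isOpen_ball) (by
      rwa [Metric.thickening_eq_biUnion_ball, biUnion_eq_iUnion] at hs)
  obtain ⟨f, hf, hfs, hf1⟩ := exists_contDiff_partition (ι := t) (isClosed_tsupport h)
    (fun p => Metric.ball (p.1 : Euc 3) r) (fun _ => Metric.isOpen_ball)
    (by simpa [iUnion_subtype] using ht)
  have hδ : 0 < 8 * r * ε / (t.card + 1) := by positivity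
  choose ψ hψs hψl hψb using fun p : t => exists_lap_eq_compl_singleton (h := fun x => f p x * h x)
    (p := (p.1 : Euc 3)) (r := r) ((hf p).mul hh)
    ((tsupport_mul_subset_left.trans (hfs p)).trans Metric.ball_subset_closedBall) hδ
  have hne : ∀ x ∉ K, ∀ p : t, x ≠ (p.1 : Euc 3) := fun x hx p hxp => hx (hxp ▸ p.1.2)
  have hat : ∀ x ∉ K, ∀ p : t, ContDiffAt ℝ ∞ (ψ p) x := fun x hx p =>
    (hψs p).contDiffAt (isOpen_compl_singleton.mem_nhds (hne x hx p))
  refine ⟨fun x => ∑ p, ψ p x, fun x hx => ?_, fun x hx => ?_, fun x hx hfar => ?_, ?_⟩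
  · exact (ContDiffAt.sum fun p _ => hat x hx p).contDiffWithinAt
  · rw [lap_sum fun p _ => (hat x hx p).of_le two_le_infty]
    simp only [hψl _ _ (hne x hx _), ← Finset.sum_mul]
    by_cases hx' : x ∈ tsupport h
    · rw [hf1 x hx', one_mul]
    · rw [image_eq_zero_of_notMem_tsupport hx', mul_zero]
  · have h1 : ∀ p : t, |ψ p x| ≤ ε / (t.card + 1) := fun p => by
      have h2 := hfar p.1 p.1.2
      have hpos : 0 < ‖x - p.1‖ := by linarith
      refine (hψb p x (hne x hx p) h2).trans ?_
      calc 8 * r * ε / (t.card + 1) * ‖x - p.1‖⁻¹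
          ≤ 8 * r * ε / (t.card + 1) * (8 * r)⁻¹ :=
            mul_le_mul_of_nonneg_left (inv_anti₀ (by positivity) h2) hδ.le
        _ = ε / (t.card + 1) := by field_simp
    calc |∑ p, ψ p x| ≤ ∑ p, |ψ p x| := Finset.abs_sum_le_sum_abs _ _
      _ ≤ ∑ _p : t, ε / (t.card + 1) := Finset.sum_le_sum fun p _ => h1 p
      _ = t.card * (ε / (t.card + 1)) := by simp
      _ ≤ ε := by
        rw [mul_div_assoc', div_le_iff₀ (by positivity)]
        nlinarith
  · rw [show (0 : ℝ) = ∑ _p : t, 0 by simp]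
    refine tendsto_finsetSum _ fun p _ => ?_
    have hnorm : Tendsto (fun x : Euc 3 => ‖x - p.1‖) (cocompact (Euc 3)) atTop := by
      refine tendsto_atTop_mono (fun x => norm_sub_norm_le x p.1) ?_
      exact tendsto_atTop_add_const_right _ _ (tendsto_norm_cocompact_atTop (E := Euc 3))
    have h1 : Tendsto (fun x : Euc 3 => 8 * r * ε / (t.card + 1) * ‖x - p.1‖⁻¹)
        (cocompact (Euc 3)) (𝓝 0) := by
      simpa using (tendsto_inv_atTop_zero.comp hnorm).const_mul (8 * r * ε / (t.card + 1))
    refine squeeze_zero_norm' ?_ h1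
    filter_upwards [hnorm.eventually (eventually_ge_atTop (8 * r))] with x hx
    exact hψb p x (fun h0 => by
      rw [h0, sub_self, norm_zero] at hx; linarith) hx

theorem lt_norm_sub_of_notMem_cthickening {K : Set (Euc 3)} {δ : ℝ} {x : Euc 3}
    (hx : x ∉ Metric.cthickening δ K) : ∀ p ∈ K, δ < ‖x - p‖ := fun p hp => by
  by_contra! h
  exact hx (Metric.mem_cthickening_of_dist_le x p δ K hp (by rwa [dist_eq_norm]))

theorem exists_notMem_cthickening {K : Set (Euc 3)} (hK : IsClosed K) {x : Euc 3} (hx : x ∉ K) :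
    ∃ N : ℕ, x ∉ Metric.cthickening (8 * (1 / 2) ^ N) K := by
  rw [← hK.closure_eq, Metric.closure_eq_iInter_cthickening] at hx
  simp only [mem_iInter, not_forall] at hx
  obtain ⟨δ, hδ, hx⟩ := hx
  obtain ⟨N, hN⟩ := exists_pow_lt_of_lt_one (by positivity : 0 < δ / 8)
    (by norm_num : (1 / 2 : ℝ) < 1)
  exact ⟨N, fun h => hx (Metric.cthickening_mono (by linarith) K h)⟩

/-- For a suitable cutoff `θ` vanishing near the compact set `K` and equal to `1` far from it, the
Poisson equation with source `(1 - θ) w` is solvable on `Kᶜ` for every `w` smooth on `Kᶜ`. -/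
theorem exists_cutoff_forall_exists_lap_eq {K : Set (Euc 3)} (hK : IsCompact K) :
    ∃ θ : Euc 3 → ℝ, ContDiff ℝ ∞ θ ∧ (∀ x ∈ K, θ =ᶠ[𝓝 x] fun _ => 0) ∧
      (∀ x ∉ Metric.thickening 1 K, θ =ᶠ[𝓝 x] fun _ => 1) ∧
      ∀ w : Euc 3 → ℝ, ContDiffOn ℝ ∞ w Kᶜ → ∃ Ψ : Euc 3 → ℝ, ContDiffOn ℝ ∞ Ψ Kᶜ ∧
        (∀ x ∉ K, lap Ψ x = (1 - θ x) * w x) ∧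
        ∀ i, Tendsto (pderiv i Ψ) (cocompact (Euc 3)) (𝓝 0) := by
  have hpos : ∀ n : ℕ, (0 : ℝ) < (1 / 2) ^ n := fun n => by positivity
  choose χ hχ hχ0 hχ1 using fun n : ℕ => exists_contDiff_eq_zero_eq_one_near
    (A := Metric.cthickening ((1 / 2) ^ n / 2) K) (B := (Metric.thickening ((1 / 2) ^ n) K)ᶜ)
    Metric.isClosed_cthickening Metric.isOpen_thickening.isClosed_compl
    (disjoint_compl_right_iff_subset.2
      (Metric.cthickening_subset_thickening' (hpos n) (by linarith [hpos n]) K))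
  have hχK : ∀ n, ∀ x ∈ K, χ n =ᶠ[𝓝 x] fun _ => 0 := fun n x hx =>
    hχ0 n x (Metric.self_subset_cthickening K hx)
  refine ⟨χ 0, hχ 0, hχK 0, fun x hx => hχ1 0 x (by simpa using hx), fun w hw => ?_⟩
  have hKo : IsOpen Kᶜ := hK.isClosed.isOpen_compl
  set h : ℕ → Euc 3 → ℝ := fun n x => (χ (n + 1) x - χ n x) * w x with hh
  have hhs : ∀ n, ContDiff ℝ ∞ (h n) := fun n =>
    hw.contDiff_mul_of_eq_zero_near (k := ⊤) hKo ((hχ (n + 1)).sub (hχ n)) fun x hx => by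
      rw [compl_compl] at hx
      filter_upwards [hχK (n + 1) x hx, hχK n x hx] with y h1 h2
      rw [h1, h2, sub_zero]
  have hhz : ∀ n, ∀ x ∉ Metric.thickening ((1 / 2) ^ n) K, h n =ᶠ[𝓝 x] fun _ => 0 := by
    intro n x hx
    have hx' : x ∉ Metric.thickening ((1 / 2) ^ (n + 1)) K := fun hx' =>
      hx (Metric.thickening_mono (pow_le_pow_of_le_one (by norm_num) (by norm_num) n.le_succ) K hx')
    filter_upwards [hχ1 n x hx, hχ1 (n + 1) x hx'] with y h1 h2
    simp [hh, h1, h2]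
  have hht : ∀ n, tsupport (h n) ⊆ Metric.thickening ((1 / 2) ^ n) K := fun n x hx => by
    by_contra hx'
    exact notMem_tsupport_iff_eventuallyEq.2 (hhz n x hx') hx
  have hhc : ∀ n, HasCompactSupport (h n) := fun n =>
    (hK.cthickening (r := (1 / 2) ^ n)).of_isClosed_subset (isClosed_tsupport _)
      ((hht n).trans (Metric.thickening_subset_cthickening _ _))
  choose ψ hψs hψl hψb hψ0 using fun n : ℕ =>
    exists_lap_eq_compl (K := K) (hhs n) (hhc n) (hpos n) (hht n) (hpos n)
  set V : ℕ → Set (Euc 3) := fun N => (Metric.cthickening (8 * (1 / 2) ^ N) K)ᶜ with hV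
  have hVo : ∀ N, IsOpen (V N) := fun N => Metric.isClosed_cthickening.isOpen_compl
  have hVK : ∀ N, ∀ x ∈ V N, x ∉ K := fun N x hx hxK => hx (Metric.self_subset_cthickening K hxK)
  have hVm : ∀ {N n : ℕ}, N ≤ n → V N ⊆ V n := fun hNn =>
    compl_subset_compl.2 (Metric.cthickening_mono
      (by linarith [pow_le_pow_of_le_one (by norm_num : (0 : ℝ) ≤ 1 / 2) (by norm_num) hNn]) K)
  have hVt : ∀ N, ∀ x ∈ V N, x ∉ Metric.thickening ((1 / 2) ^ N) K := fun N x hx hx' =>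
    hx (Metric.cthickening_mono (by linarith [hpos N]) K
      (Metric.thickening_subset_cthickening _ _ hx'))
  have hψV : ∀ n, ∀ x ∈ V n, ‖ψ n x‖ ≤ (1 / 2) ^ n := fun n x hx =>
    hψb n x (hVK n x hx) fun p hp => (lt_norm_sub_of_notMem_cthickening hx p hp).le
  have hψat : ∀ n, ∀ x ∉ K, ContDiffAt ℝ ∞ (ψ n) x := fun n x hx =>
    (hψs n).contDiffAt (hKo.mem_nhds hx)
  have hgeo : Summable fun n : ℕ => (1 / 2 : ℝ) ^ n := summable_geometric_two
  set τ : ℕ → Euc 3 → ℝ := fun N x => ∑' k, ψ (N + k) x with hτ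
  have hτm : ∀ N, HasMeanValue (V N) (τ N) := fun N => by
    refine HasMeanValue.of_tendstoUniformlyOn (F := fun m x => ∑ k ∈ Finset.range m, ψ (N + k) x)
      (hVo N) (fun m => ?_) ?_
    · refine hasMeanValue_of_lap_eq_zero (hVo N) (fun x hx => ?_) fun x hx => ?_
      · exact (ContDiffAt.sum fun k _ =>
          (hψat (N + k) x (hVK N x hx)).of_le two_le_infty).contDiffWithinAt
      · rw [lap_sum fun k _ => (hψat (N + k) x (hVK N x hx)).of_le two_le_infty]
        refine Finset.sum_eq_zero fun k _ => ?_
        rw [hψl (N + k) x (hVK N x hx)]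
        exact (hhz (N + k) x (hVt _ x (hVm (N.le_add_right k) hx))).eq_of_nhds
    · refine tendstoUniformlyOn_tsum_nat (u := fun k => (1 / 2 : ℝ) ^ (N + k)) ?_ ?_
      · simpa [pow_add] using hgeo.mul_left ((1 / 2 : ℝ) ^ N)
      · exact fun k x hx => hψV (N + k) x (hVm (N.le_add_right k) hx)
  set Ψ : Euc 3 → ℝ := fun x => ∑' n, ψ n x with hΨ
  have hsplit : ∀ N, ∀ x ∈ V N, Ψ x = ∑ n ∈ Finset.range N, ψ n x + τ N x := fun N x hx => by
    have hsum : Summable fun n => ψ n x := by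
      refine (summable_nat_add_iff N).1 (Summable.of_norm_bounded
        (g := fun n => (1 / 2 : ℝ) ^ (n + N)) ((summable_nat_add_iff N).2 hgeo) fun n => ?_)
      exact hψV _ x (hVm (N.le_add_left n) hx)
    rw [hΨ, hτ]
    simp only [add_comm N]
    exact (hsum.sum_add_tsum_nat_add N).symm
  have hev : ∀ N, ∀ x ∈ V N, Ψ =ᶠ[𝓝 x] fun y => ∑ n ∈ Finset.range N, ψ n y + τ N y :=
    fun N x hx => by filter_upwards [(hVo N).mem_nhds hx] with y hy using hsplit N y hy
  have hsums : ∀ N, ∀ x ∉ K, ContDiffAt ℝ ∞ (fun y => ∑ n ∈ Finset.range N, ψ n y) x :=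
    fun N x hx => ContDiffAt.sum fun n _ => hψat n x hx
  have hτs : ∀ N, ∀ x ∈ V N, ContDiffAt ℝ ∞ (τ N) x := fun N x hx =>
    ((hτm N).contDiffOn (hVo N)).contDiffAt ((hVo N).mem_nhds hx)
  have hΨs : ContDiffOn ℝ ∞ Ψ Kᶜ := fun x hx => by
    obtain ⟨N, hN⟩ := exists_notMem_cthickening hK.isClosed hx
    exact (((hsums N x hx).add (hτs N x hN)).congr_of_eventuallyEq (hev N x hN)).contDiffWithinAt
  have hΨl : ∀ x ∉ K, lap Ψ x = (1 - χ 0 x) * w x := fun x hx => by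
    obtain ⟨N, hN⟩ := exists_notMem_cthickening hK.isClosed hx
    rw [(hev N x hN).lap_eq, lap_add ((hsums N x hx).of_le two_le_infty)
      ((hτs N x hN).of_le two_le_infty), (hτm N).lap_eq_zero (hVo N) hN, add_zero,
      lap_sum fun n _ => (hψat n x hx).of_le two_le_infty]
    simp only [hψl _ x hx, hh, ← Finset.sum_mul]
    rw [Finset.sum_range_sub (fun n => χ n x), (hχ1 N x (hVt N x hN)).eq_of_nhds]
  have hVev : ∀ᶠ x in cocompact (Euc 3), x ∈ V 0 :=
    (hK.cthickening (r := 8 * (1 / 2) ^ 0)).compl_mem_cocompact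
  have hΨ0 : Tendsto Ψ (cocompact (Euc 3)) (𝓝 0) := by
    rw [← tsum_zero (α := ℝ) (β := ℕ)]
    refine tendsto_tsum_of_dominated_convergence hgeo hψ0 ?_
    filter_upwards [hVev] with x hx n
    exact hψV n x (hVm n.zero_le hx)
  refine ⟨Ψ, hΨs, hΨl, fun i => ?_⟩
  obtain ⟨ρ, hρ⟩ := (hK.cthickening (r := 8 * (1 / 2) ^ 0)).isBounded.subset_closedBall (0 : Euc 3)
  refine HasMeanValue.tendsto_pderiv_cocompact (U := V 0) (by rwa [hV, compl_compl]) ?_ hΨ0 i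
  refine hasMeanValue_of_lap_eq_zero (hVo 0)
    ((hΨs.of_le two_le_infty).mono fun x hx => hVK 0 x hx) fun x hx => ?_
  rw [hΨl x (hVK 0 x hx), (hχ1 0 x (hVt 0 x hx)).eq_of_nhds, sub_self, zero_mul]

theorem curl_apply (v : Euc 3 → Fin 3 → ℝ) (x : Euc 3) (i : Fin 3) :
    curl v x i = pderiv (i + 1) (fun y => v y (i + 2)) x
      - pderiv (i + 2) (fun y => v y (i + 1)) x := by
  fin_cases i <;> rfl

theorem sum_fin_three_cyclic (a : Fin 3 → ℝ) (i : Fin 3) :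
    ∑ j, a j = a i + a (i + 1) + a (i + 2) := by
  rw [Fin.sum_univ_three]
  fin_cases i
  · rfl
  · change _ = a 1 + a 2 + a 0; ring
  · change _ = a 2 + a 0 + a 1; ring

theorem fin_three_add_one_add_two (i : Fin 3) : i + 1 + 2 = i := by fin_cases i <;> rfl

theorem fin_three_add_two_add_one (i : Fin 3) : i + 2 + 1 = i := by fin_cases i <;> rfl

theorem fin_three_add_one_add_one (i : Fin 3) : i + 1 + 1 = i + 2 := by fin_cases i <;> rfl

theorem fin_three_add_two_add_two (i : Fin 3) : i + 2 + 2 = i + 1 := by fin_cases i <;> rfl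

theorem three_le_infty : (3 : ℕ∞ω) ≤ ∞ := WithTop.coe_le_coe.2 (le_top : (3 : ℕ∞) ≤ ⊤)

theorem lap_sub {n : ℕ} {f g : Euc n → ℝ} {x : Euc n} (hf : ContDiffAt ℝ 2 f x)
    (hg : ContDiffAt ℝ 2 g x) : lap (fun y => f y - g y) x = lap f x - lap g x := by
  have h := lap_add hf (contDiffAt_const.mul hg : ContDiffAt ℝ 2 (fun y => (-1) * g y) x)
  rw [lap_const_mul _ hg] at h
  simpa [sub_eq_add_neg] using h

section VectorCalculus

variable {v w : Euc 3 → Fin 3 → ℝ} {x : Euc 3}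

theorem ContDiffAt.divg (hv : ∀ i, ContDiffAt ℝ ∞ (fun y => v y i) x) :
    ContDiffAt ℝ ∞ (divg v) x :=
  ContDiffAt.sum fun i _ => (hv i).pderiv i (by simp)

theorem ContDiffAt.curl (hv : ∀ i, ContDiffAt ℝ ∞ (fun y => v y i) x) (i : Fin 3) :
    ContDiffAt ℝ ∞ (fun y => curl v y i) x := by
  simp only [curl_apply]
  exact ((hv _).pderiv _ (by simp)).sub ((hv _).pderiv _ (by simp))

theorem curl_sub (hv : ∀ i, DifferentiableAt ℝ (fun y => v y i) x)
    (hw : ∀ i, DifferentiableAt ℝ (fun y => w y i) x) (i : Fin 3) :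
    curl (fun y j => v y j - w y j) x i = curl v x i - curl w x i := by
  simp only [curl_apply, pderiv_sub (hv _) (hw _)]
  ring

theorem curl_neg (i : Fin 3) : curl (fun y j => - v y j) x i = - curl v x i := by
  simp only [curl_apply, pderiv_neg]
  ring

theorem divg_sub (hv : ∀ i, DifferentiableAt ℝ (fun y => v y i) x)
    (hw : ∀ i, DifferentiableAt ℝ (fun y => w y i) x) :
    divg (fun y j => v y j - w y j) x = divg v x - divg w x := by
  simp only [divg, pderiv_sub (hv _) (hw _), Finset.sum_sub_distrib]

theorem divg_neg : divg (fun y j => - v y j) x = - divg v x := by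
  simp only [divg, pderiv_neg, Finset.sum_neg_distrib]

theorem curl_congr (h : ∀ i, (fun y => v y i) =ᶠ[𝓝 x] fun y => w y i) (i : Fin 3) :
    curl v x i = curl w x i := by
  simp only [curl_apply, ((h _).pderiv _).eq_of_nhds]

theorem divg_congr (h : ∀ i, (fun y => v y i) =ᶠ[𝓝 x] fun y => w y i) :
    divg v x = divg w x := by
  simp only [divg, ((h _).pderiv _).eq_of_nhds]

theorem divg_curl (hv : ∀ i, ContDiffAt ℝ ∞ (fun y => v y i) x) : divg (curl v) x = 0 := by
  have hd : ∀ i j, DifferentiableAt ℝ (pderiv j fun y => v y i) x := fun i j =>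
    ((hv i).of_le two_le_infty).differentiableAt_pderiv j
  have hc : ∀ i j k, pderiv j (pderiv k fun y => v y i) x = pderiv k (pderiv j fun y => v y i) x :=
    fun i j k => pderiv_comm ((hv i).of_le two_le_infty) j k
  simp only [divg, curl_apply, pderiv_sub (hd _ _) (hd _ _), Fin.sum_univ_three, Fin.isValue]
  change pderiv 0 (pderiv 1 fun y => v y 2) x - pderiv 0 (pderiv 2 fun y => v y 1) x
    + (pderiv 1 (pderiv 2 fun y => v y 0) x - pderiv 1 (pderiv 0 fun y => v y 2) x)
    + (pderiv 2 (pderiv 0 fun y => v y 1) x - pderiv 2 (pderiv 1 fun y => v y 0) x) = 0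
  rw [hc 2 0 1, hc 1 0 2, hc 0 1 2]
  ring

theorem pderiv_divg_sub_curl_curl (hv : ∀ i, ContDiffAt ℝ ∞ (fun y => v y i) x) (i : Fin 3) :
    pderiv i (divg v) x - curl (curl v) x i = lap (fun y => v y i) x := by
  have hd : ∀ i j, DifferentiableAt ℝ (pderiv j fun y => v y i) x := fun i j =>
    ((hv i).of_le two_le_infty).differentiableAt_pderiv j
  have hc : ∀ i j k, pderiv j (pderiv k fun y => v y i) x = pderiv k (pderiv j fun y => v y i) x :=
    fun i j k => pderiv_comm ((hv i).of_le two_le_infty) j k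
  rw [show divg v = fun y => ∑ j, pderiv j (fun y => v y j) y from rfl,
    pderiv_sum fun j _ => hd j j, curl_apply]
  simp only [curl_apply, pderiv_sub (hd _ _) (hd _ _), lap, sum_fin_three_cyclic _ i,
    fin_three_add_one_add_two, fin_three_add_two_add_one, fin_three_add_one_add_one,
    fin_three_add_two_add_two]
  rw [hc (i + 1) (i + 1) i, hc (i + 2) (i + 2) i]
  ring

theorem lap_divg (hv : ∀ i, ContDiffAt ℝ ∞ (fun y => v y i) x) :
    lap (divg v) x = divg (fun y i => lap (fun z => v z i) y) x := by
  rw [show divg v = fun y => ∑ j, pderiv j (fun y => v y j) y from rfl,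
    lap_sum fun j _ => (hv j).pderiv j three_le_infty]
  exact Finset.sum_congr rfl fun j _ => lap_pderiv ((hv j).of_le three_le_infty) j

theorem lap_curl (hv : ∀ i, ContDiffAt ℝ ∞ (fun y => v y i) x) (i : Fin 3) :
    lap (fun y => curl v y i) x = curl (fun y j => lap (fun z => v z j) y) x i := by
  simp only [curl_apply]
  rw [lap_sub ((hv _).pderiv _ three_le_infty) ((hv _).pderiv _ three_le_infty),
    lap_pderiv ((hv _).of_le three_le_infty), lap_pderiv ((hv _).of_le three_le_infty)]

end VectorCalculus

theorem tendsto_divg {v : Euc 3 → Fin 3 → ℝ} {l : Filter (Euc 3)}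
    (h : ∀ i j, Tendsto (pderiv j fun y => v y i) l (𝓝 0)) : Tendsto (divg v) l (𝓝 0) := by
  rw [show (0 : ℝ) = ∑ _i : Fin 3, 0 by simp]
  exact tendsto_finsetSum _ fun i _ => h i i

theorem tendsto_curl {v : Euc 3 → Fin 3 → ℝ} {l : Filter (Euc 3)}
    (h : ∀ i j, Tendsto (pderiv j fun y => v y i) l (𝓝 0)) (i : Fin 3) :
    Tendsto (fun y => curl v y i) l (𝓝 0) := by
  simp only [curl_apply]
  simpa using (h (i + 2) (i + 1)).sub (h (i + 1) (i + 2))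

/-- The Poisson equation on `ℝ³` with a compactly supported source. -/
theorem exists_lap_eq_of_hasCompactSupport {g : Euc 3 → ℝ} (hg : ContDiff ℝ ∞ g)
    (hc : HasCompactSupport g) : ∃ φ : Euc 3 → ℝ, ContDiff ℝ ∞ φ ∧ (∀ x, lap φ x = g x) ∧
      Tendsto φ (cocompact (Euc 3)) (𝓝 0) ∧
      ∀ i, Tendsto (pderiv i φ) (cocompact (Euc 3)) (𝓝 0) := by
  have hN := contDiff_newtonPotential hg hc
  have hC := newtonConst_pos.ne'
  refine ⟨fun x => -newtonConst⁻¹ * newtonPotential g x, contDiff_const.mul hN, fun x => ?_, ?_,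
    fun i => ?_⟩
  · rw [lap_const_mul _ (hN.contDiffAt.of_le two_le_infty), lap_newtonPotential hg hc]
    field_simp
  · simpa using (tendsto_newtonPotential hg.continuous hc).const_mul (-newtonConst⁻¹)
  · have h1 : pderiv i (fun x => -newtonConst⁻¹ * newtonPotential g x)
        = fun x => -newtonConst⁻¹ * newtonPotential (pderiv i g) x := funext fun x => by
      rw [pderiv_const_mul _ (hN.differentiable (by simp) x), pderiv_newtonPotential hg hc]
    rw [h1]
    simpa using (tendsto_newtonPotential (hg.pderiv i (m := ∞) (by simp)).continuous
      (hc.pderiv i)).const_mul (-newtonConst⁻¹)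

theorem eq_zero_of_lap_eq_zero_of_tendsto {E : Euc 3 → ℝ} (hE : ContDiff ℝ 2 E)
    (hl : ∀ x, lap E x = 0) (h0 : Tendsto E (cocompact (Euc 3)) (𝓝 0)) (x : Euc 3) : E x = 0 :=
  (hasMeanValue_of_lap_eq_zero isOpen_univ hE.contDiffOn fun x _ => hl x).eq_zero_of_tendsto h0 x

/-- Helmholtz decomposition of a smooth field on `ℝ³` vanishing at infinity whose divergence and
curl have compact support. -/
theorem exists_helmholtz_decomposition {W : Euc 3 → Fin 3 → ℝ}
    (hW : ∀ i, ContDiff ℝ ∞ fun x => W x i)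
    (hW0 : ∀ i, Tendsto (fun x => W x i) (cocompact (Euc 3)) (𝓝 0))
    (hd : HasCompactSupport (divg W)) (hc : ∀ i, HasCompactSupport fun x => curl W x i) :
    ∃ f : Euc 3 → ℝ, ∃ v : Euc 3 → Fin 3 → ℝ, ContDiff ℝ ∞ f ∧
      (∀ i, ContDiff ℝ ∞ fun x => v x i) ∧ Tendsto f (cocompact (Euc 3)) (𝓝 0) ∧
      (∀ i, Tendsto (fun x => v x i) (cocompact (Euc 3)) (𝓝 0)) ∧
      (∀ x, lap f x = divg W x) ∧ (∀ x i, lap (fun y => v y i) x = - curl W x i) ∧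
      (∀ x, divg v x = 0) ∧ ∀ x i, W x i = pderiv i f x + curl v x i := by
  have hWat : ∀ x i, ContDiffAt ℝ ∞ (fun x => W x i) x := fun x i => (hW i).contDiffAt
  have hcs : ∀ i, ContDiff ℝ ∞ fun x => curl W x i := fun i =>
    contDiff_iff_contDiffAt.2 fun x => ContDiffAt.curl (hWat x) i
  obtain ⟨f, hf, hfl, hf0, hf1⟩ := exists_lap_eq_of_hasCompactSupport
    (contDiff_iff_contDiffAt.2 fun x => ContDiffAt.divg (hWat x)) hd
  choose v' hv' hvl hv0 hv1 using fun i => exists_lap_eq_of_hasCompactSupport (hcs i).neg (hc i).neg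
  set v : Euc 3 → Fin 3 → ℝ := fun x i => v' i x with hv
  have hvat : ∀ x i, ContDiffAt ℝ ∞ (fun x => v x i) x := fun x i => (hv' i).contDiffAt
  have hvl' : (fun y j => lap (fun z => v z j) y) = fun y j => - curl W y j :=
    funext fun y => funext fun j => hvl j y
  refine ⟨f, v, hf, hv', hf0, hv0, hfl, fun x i => hvl i x, fun x => ?_, fun x i => ?_⟩
  · refine eq_zero_of_lap_eq_zero_of_tendsto (contDiff_iff_contDiffAt.2 fun x =>
      (ContDiffAt.divg (hvat x)).of_le two_le_infty) (fun x => ?_) (tendsto_divg hv1) x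
    rw [lap_divg (hvat x), hvl', divg_neg, divg_curl (hWat x), neg_zero]
  · have hfi : ContDiff ℝ ∞ (pderiv i f) := hf.pderiv i (by simp)
    have hvi : ContDiff ℝ ∞ fun x => curl v x i :=
      contDiff_iff_contDiffAt.2 fun x => ContDiffAt.curl (hvat x) i
    have h2 : ∀ {g : Euc 3 → ℝ}, ContDiff ℝ ∞ g → ∀ x, ContDiffAt ℝ 2 g x := fun hg x =>
      hg.contDiffAt.of_le two_le_infty
    have := eq_zero_of_lap_eq_zero_of_tendsto
      (E := fun y => pderiv i f y + curl v y i - W y i)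
      (((hfi.add hvi).sub (hW i)).of_le two_le_infty) (fun x => ?_) ?_ x
    · linarith
    · rw [lap_sub (h2 (hfi.add hvi) x) (h2 (hW i) x), lap_add (h2 hfi x) (h2 hvi x),
        lap_pderiv (hf.contDiffAt.of_le three_le_infty), lap_curl (hvat x), hvl', curl_neg,
        show lap f = divg W from funext hfl, ← pderiv_divg_sub_curl_curl (hWat x) i]
      ring
    · simpa using ((hf1 i).add (tendsto_curl hv1 i)).sub (hW0 i)

theorem tendsto_cocompact_zero_iff {ι : Type*} [Finite ι] {g : ι → Euc 3 → ℝ} :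
    (∀ i, Tendsto (g i) (cocompact (Euc 3)) (𝓝 0)) ↔
      ∀ ε > 0, ∃ R : ℝ, ∀ x : Euc 3, R < ‖x‖ → ∀ i, |g i x| < ε := by
  simp only [Metric.tendsto_nhds, Real.dist_0_eq_abs]
  have key : ∀ p : Euc 3 → Prop, (∀ᶠ x in cocompact (Euc 3), p x) ↔
      ∃ R : ℝ, ∀ x : Euc 3, R < ‖x‖ → p x := fun p => by
    rw [← Metric.cobounded_eq_cocompact,
      (Metric.hasBasis_cobounded_compl_closedBall (0 : Euc 3)).eventually_iff]
    simp
  simp only [← key, eventually_all]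
  exact ⟨fun h ε hε i => h i ε hε, fun h i ε hε => h ε hε i⟩

theorem pderiv_comm_of_curl_eq_zero {u : Euc 3 → Fin 3 → ℝ} {x : Euc 3} (h : curl u x = 0)
    (i j : Fin 3) : pderiv i (fun y => u y j) x = pderiv j (fun y => u y i) x := by
  have h0 := congrFun h 0
  have h1 := congrFun h 1
  have h2 := congrFun h 2
  simp only [curl, Matrix.cons_val, Pi.zero_apply] at h0 h1 h2
  fin_cases i <;> fin_cases j <;> simp only [Fin.zero_eta, Fin.mk_one, Fin.reduceFinMk] <;> linarith

/-- a `C¹` harmonic vector field `ū` on `ℝ³ ∖ K` vanishing at infinity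
is of the form `ū = grad f + curl v̄` with `f`, `v̄` vanishing at infinity,
`Δf = 0`, `Δv̄ = 0` (componentwise) and `div v̄ = 0` on `ℝ³ ∖ K`. -/
theorem stmt17 (K : Set (Euc 3)) (hK : IsCompact K)
    (u : Euc 3 → Fin 3 → ℝ)
    (hu : ∀ i, ContDiffOn ℝ 1 (fun x => u x i) Kᶜ)
    (hcurl : ∀ x ∉ K, curl u x = 0) (hdiv : ∀ x ∉ K, divg u x = 0)
    (hinf : ∀ ε > 0, ∃ R : ℝ, ∀ x : Euc 3, R < ‖x‖ → ∀ i, |u x i| < ε) :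
    ∃ f : Euc 3 → ℝ, ∃ v : Euc 3 → Fin 3 → ℝ,
      ContDiffOn ℝ 2 f Kᶜ ∧ (∀ i, ContDiffOn ℝ 2 (fun x => v x i) Kᶜ) ∧
      (∀ ε > 0, ∃ R : ℝ, ∀ x : Euc 3, R < ‖x‖ → |f x| < ε ∧ ∀ i, |v x i| < ε) ∧
      (∀ x ∉ K, lap f x = 0) ∧
      (∀ x ∉ K, ∀ i, lap (fun y => v y i) x = 0) ∧
      (∀ x ∉ K, divg v x = 0) ∧
      (∀ x ∉ K, ∀ i, u x i = pderiv i f x + curl v x i) := by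
  have hU : IsOpen Kᶜ := hK.isClosed.isOpen_compl
  have hu' : ∀ i, ContDiffOn ℝ ∞ (fun x => u x i) Kᶜ := fun i =>
    (hasMeanValue_of_curl_div_eq_zero hU hu
      (fun x hx => pderiv_comm_of_curl_eq_zero (hcurl x hx)) (fun x hx => hdiv x hx) i).contDiffOn hU
  have hu0 : ∀ i, Tendsto (fun x => u x i) (cocompact (Euc 3)) (𝓝 0) :=
    tendsto_cocompact_zero_iff.2 hinf
  obtain ⟨θ, hθ, hθ0, hθ1, hΨ⟩ := exists_cutoff_forall_exists_lap_eq hK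
  choose Ψ' hΨ' hΨl hΨ0 using fun i => hΨ _ (hu' i)
  set Ψ : Euc 3 → Fin 3 → ℝ := fun x i => Ψ' i x
  set W : Euc 3 → Fin 3 → ℝ := fun x i => θ x * u x i with hWdef
  have hW : ∀ i, ContDiff ℝ ∞ fun x => W x i := fun i =>
    ContDiffOn.contDiff_mul_of_eq_zero_near (k := ⊤) hU (hu' i) hθ
      fun x hx => hθ0 x (not_not.1 hx)
  have hWu : ∀ x ∉ Metric.cthickening 1 K, ∀ i, (fun y => W y i) =ᶠ[𝓝 x] fun y => u y i :=
    fun x hx i => (hθ1 x fun h => hx (Metric.thickening_subset_cthickening _ _ h)).mono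
      fun y hy => by simp [hWdef, hy]
  have hKc : IsCompact (Metric.cthickening 1 K) := hK.cthickening
  have hKs : ∀ x ∉ Metric.cthickening 1 K, x ∉ K := fun x hx h =>
    hx (Metric.self_subset_cthickening K h)
  have hW0 : ∀ i, Tendsto (fun x => W x i) (cocompact (Euc 3)) (𝓝 0) := fun i =>
    (hu0 i).congr' <| mem_of_superset hKc.compl_mem_cocompact fun x hx =>
      (hWu x hx i).eq_of_nhds.symm
  obtain ⟨f₀, v₀, hf, hv, hf0, hv0, hfl, hvl, hvd, hfv⟩ := exists_helmholtz_decomposition hW hW0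
    (HasCompactSupport.intro hKc fun x hx => (divg_congr (hWu x hx)).trans (hdiv x (hKs x hx)))
    fun i => HasCompactSupport.intro hKc fun x hx =>
      (curl_congr (hWu x hx) i).trans (congrFun (hcurl x (hKs x hx)) i)
  have huat : ∀ x ∉ K, ∀ i, ContDiffAt ℝ ∞ (fun y => u y i) x := fun x hx i =>
    (hu' i).contDiffAt (hU.mem_nhds hx)
  have hΨat : ∀ x ∉ K, ∀ i, ContDiffAt ℝ ∞ (fun y => Ψ y i) x := fun x hx i =>
    (hΨ' i).contDiffAt (hU.mem_nhds hx)
  have hvat : ∀ x i, ContDiffAt ℝ ∞ (fun y => v₀ y i) x := fun x i => (hv i).contDiffAt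
  have hΨu : ∀ x ∉ K, ∀ i, lap (fun z => Ψ z i) x = u x i - W x i := fun x hx i => by
    rw [show lap (fun z => Ψ z i) x = _ from hΨl i x hx]
    ring
  have hΨu' : ∀ x ∉ K, ∀ i, (fun y => lap (fun z => Ψ z i) y) =ᶠ[𝓝 x] fun y => u y i - W y i :=
    fun x hx i => mem_of_superset (hU.mem_nhds hx) fun y hy => hΨu y hy i
  have hdu : ∀ x ∉ K, ∀ i, DifferentiableAt ℝ (fun y => u y i) x := fun x hx i =>
    (huat x hx i).differentiableAt (by simp)
  have hdW : ∀ x i, DifferentiableAt ℝ (fun y => W y i) x := fun x i =>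
    (hW i).differentiable (by simp) x
  have hdv : ∀ x i, DifferentiableAt ℝ (fun y => v₀ y i) x := fun x i =>
    (hv i).differentiable (by simp) x
  have hdc : ∀ x ∉ K, ∀ i, DifferentiableAt ℝ (fun y => curl Ψ y i) x := fun x hx i =>
    (ContDiffAt.curl (hΨat x hx) i).differentiableAt (by simp)
  have hfs : ∀ x ∉ K, ContDiffAt ℝ 2 (divg Ψ) x := fun x hx =>
    (ContDiffAt.divg (hΨat x hx)).of_le two_le_infty
  have hvs : ∀ x ∉ K, ∀ i, ContDiffAt ℝ 2 (fun y => curl Ψ y i) x := fun x hx i =>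
    (ContDiffAt.curl (hΨat x hx) i).of_le two_le_infty
  have hf2 : ∀ x, ContDiffAt ℝ 2 f₀ x := fun x => hf.contDiffAt.of_le two_le_infty
  have hv2 : ∀ x i, ContDiffAt ℝ 2 (fun y => v₀ y i) x := fun x i =>
    (hvat x i).of_le two_le_infty
  refine ⟨fun y => f₀ y + divg Ψ y, fun y i => v₀ y i - curl Ψ y i,
    fun x hx => ((hf2 x).add (hfs x hx)).contDiffWithinAt,
    fun i x hx => ((hv2 x i).sub (hvs x hx i)).contDiffWithinAt, ?_, fun x hx => ?_,
    fun x hx i => ?_, fun x hx => ?_, fun x hx i => ?_⟩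
  · have h := (tendsto_cocompact_zero_iff
      (g := fun o : Option (Fin 3) => o.elim (fun y => f₀ y + divg Ψ y)
        fun i y => v₀ y i - curl Ψ y i)).1 <| Option.forall.2
      ⟨by simpa using hf0.add (tendsto_divg (v := Ψ) hΨ0),
        fun i => by simpa using (hv0 i).sub (tendsto_curl (v := Ψ) hΨ0 i)⟩
    simpa only [Option.forall, Option.elim] using h
  · rw [lap_add (hf2 x) (hfs x hx), hfl, lap_divg (hΨat x hx), divg_congr (hΨu' x hx),
      divg_sub (hdu x hx) (hdW x), hdiv x hx]
    ring
  · rw [lap_sub (hv2 x i) (hvs x hx i), hvl, lap_curl (hΨat x hx), curl_congr (hΨu' x hx),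
      curl_sub (hdu x hx) (hdW x), hcurl x hx, Pi.zero_apply]
    ring
  · rw [divg_sub (hdv x) (hdc x hx), hvd, divg_curl (hΨat x hx), sub_zero]
  · have h := pderiv_divg_sub_curl_curl (hΨat x hx) i
    rw [hΨu x hx] at h
    rw [pderiv_add ((hf2 x).differentiableAt (by simp)) ((hfs x hx).differentiableAt (by simp)),
      curl_sub (hdv x) (hdc x hx)]
    linarith [hfv x i]
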